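/- For every ranked alphabet Σ and every k ≥ 1, the family of tree languages over Σ accepted by deterministic k-head tree-walking automata with nested pebbles equals the family of tree languages over Σ definable in first-order logic with k-ary deterministic transitive closure: DPTWA^k = FO+DTC^k. -/

import Mathlib

namespace NestedPebbles

/-- Trees over a ranked alphabet `(Sig, rank)`: terms `σ(t₁,…,tₙ)` with `rank σ = n`. -/
inductive RTree (Sig : Type) (rank : Sig → ℕ) : Type
  | node (a : Sig) (children : Fin (rank a) → RTree Sig rank) : RTree Sig rank

namespace RTree

variable {Sig : Type} {rank : Sig → ℕ}

/-- The label of the root symbol. -/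
def label : RTree Sig rank → Sig
  | node a _ => a

/-- The `i`-th (0-based) immediate subtree, if it exists. -/
def child : RTree Sig rank → ℕ → Option (RTree Sig rank)
  | node a c, i => if h : i < rank a then some (c ⟨i, h⟩) else none

/-- The subtree at a position (a list of 0-based child indices, read from the root). -/
def subtree : RTree Sig rank → List ℕ → Option (RTree Sig rank)
  | t, [] => some t
  | t, i :: p => (t.child i).bind fun s => s.subtree p

end RTree

variable {Sig : Type} {rank : Sig → ℕ}

/-- `p` is (the address of) a node of `t`. -/
def IsPos (t : RTree Sig rank) (p : List ℕ) : Prop := (t.subtree p).isSome = true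

/-- The type of nodes of a tree `t`, as valid positions. -/
def Pos (t : RTree Sig rank) : Type := { p : List ℕ // IsPos t p }

/-- The root node. -/
def rootPos (t : RTree Sig rank) : Pos t := ⟨[], rfl⟩

/-- The label of the node of `t` at position `p`. -/
def labelAt (t : RTree Sig rank) (p : List ℕ) : Option Sig := (t.subtree p).map RTree.label

/-- The child number of a node: `0` for the root, and `j` for a `j`-th child (1-based). -/
def childNo (p : List ℕ) : ℕ :=
  match p.getLast? with
  | none => 0
  | some j => j + 1

/-!  ### First-order logic with k-ary transitive closure, on trees  -/

/-- First-order formulas over a ranked alphabet, with a `k`-ary transitive closure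
operator.  Variables are natural numbers.  `lab a x` means `x` has label `a`;
`edg i x y` means `y` is the `i`-th child of `x` (`i` is 1-based);
`le x y` means `x` is an ancestor of `y`; `tc xs ys φ us vs` is the transitive
closure `φ*` of `φ` with respect to the tuples of variables `xs`, `ys` (which it
binds), applied to the tuples of variables `us`, `vs`. -/
inductive TForm (Sig : Type) (rank : Sig → ℕ) (k : ℕ) : Type
  | lab (a : Sig) (x : ℕ)
  | edg (i : ℕ) (x y : ℕ)
  | le (x y : ℕ)
  | eq (x y : ℕ)
  | not (φ : TForm Sig rank k)
  | and (φ ψ : TForm Sig rank k)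
  | or (φ ψ : TForm Sig rank k)
  | ex (x : ℕ) (φ : TForm Sig rank k)
  | all (x : ℕ) (φ : TForm Sig rank k)
  | tc (xs ys : Fin k → ℕ) (φ : TForm Sig rank k) (us vs : Fin k → ℕ)

/-- Update a valuation on a tuple of variables simultaneously. -/
noncomputable def updVec {α : Type} {k : ℕ} (ν : ℕ → α) (xs : Fin k → ℕ) (a : Fin k → α) :
    ℕ → α :=
  fun n => if h : ∃ i, xs i = n then a h.choose else ν n

/-- Satisfaction of a formula in a tree `t` under a valuation of the variables by
nodes of `t`. -/
def Sat {k : ℕ} (t : RTree Sig rank) : TForm Sig rank k → (ℕ → Pos t) → Prop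
  | .lab a x, ν => labelAt t (ν x).1 = some a
  | .edg i x y, ν => 1 ≤ i ∧ (ν y).1 = (ν x).1 ++ [i - 1]
  | .le x y, ν => (ν x).1 <+: (ν y).1
  | .eq x y, ν => ν x = ν y
  | .not φ, ν => ¬ Sat t φ ν
  | .and φ ψ, ν => Sat t φ ν ∧ Sat t ψ ν
  | .or φ ψ, ν => Sat t φ ν ∨ Sat t ψ ν
  | .ex x φ, ν => ∃ u : Pos t, Sat t φ (Function.update ν x u)
  | .all x φ, ν => ∀ u : Pos t, Sat t φ (Function.update ν x u)
  | .tc xs ys φ us vs, ν =>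
      Relation.ReflTransGen
        (fun a b : Fin k → Pos t => Sat t φ (updVec (updVec ν xs a) ys b))
        (fun i => ν (us i)) (fun i => ν (vs i))

/-- The free variables of a formula. -/
def freeVars {k : ℕ} : TForm Sig rank k → Set ℕ
  | .lab _ x => {x}
  | .edg _ x y => {x, y}
  | .le x y => {x, y}
  | .eq x y => {x, y}
  | .not φ => freeVars φ
  | .and φ ψ => freeVars φ ∪ freeVars ψ
  | .or φ ψ => freeVars φ ∪ freeVars ψ
  | .ex x φ => freeVars φ \ {x}
  | .all x φ => freeVars φ \ {x}
  | .tc xs ys φ us vs =>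
      (freeVars φ \ (Set.range xs ∪ Set.range ys)) ∪ Set.range us ∪ Set.range vs

/-- Two `k`-tuples of variables consist of `2k` pairwise distinct variables. -/
def Distinct2 {k : ℕ} (xs ys : Fin k → ℕ) : Prop :=
  Function.Injective xs ∧ Function.Injective ys ∧ ∀ i j, xs i ≠ ys j

/-- `φ` is functional in the tuples of variables `xs`, `ys`: for every tree, every
valuation of the remaining variables, and every value of `xs`, there is at most one
value of `ys` satisfying `φ`. -/
def FunctionalIn {k : ℕ} (φ : TForm Sig rank k) (xs ys : Fin k → ℕ) : Prop :=
  ∀ (t : RTree Sig rank) (ν : ℕ → Pos t) (a b b' : Fin k → Pos t),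
    Sat t φ (updVec (updVec ν xs a) ys b) →
    Sat t φ (updVec (updVec ν xs a) ys b') → b = b'

/-- Well-formedness: in each transitive closure the `2k` bound variables are
pairwise distinct and occur free in the body. -/
def WF {k : ℕ} : TForm Sig rank k → Prop
  | .not φ => WF φ
  | .and φ ψ => WF φ ∧ WF ψ
  | .or φ ψ => WF φ ∧ WF ψ
  | .ex _ φ => WF φ
  | .all _ φ => WF φ
  | .tc xs ys φ _ _ =>
      Distinct2 xs ys ∧ (Set.range xs ∪ Set.range ys) ⊆ freeVars φ ∧ WF φ
  | _ => True

/-- All transitive closures occurring in the formula are deterministic, i.e., applied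
to functional formulas. -/
def DetTC {k : ℕ} : TForm Sig rank k → Prop
  | .not φ => DetTC φ
  | .and φ ψ => DetTC φ ∧ DetTC ψ
  | .or φ ψ => DetTC φ ∧ DetTC ψ
  | .ex _ φ => DetTC φ
  | .all _ φ => DetTC φ
  | .tc xs ys φ _ _ => FunctionalIn φ xs ys ∧ DetTC φ
  | _ => True

/-- All occurrences of transitive closure are positive (within the scope of an even
number of negations); the polarity parameter `b` is `true` for an even number. -/
def PosTC {k : ℕ} : Bool → TForm Sig rank k → Prop
  | b, .not φ => PosTC (!b) φ
  | b, .and φ ψ => PosTC b φ ∧ PosTC b ψ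
  | b, .or φ ψ => PosTC b φ ∧ PosTC b ψ
  | b, .ex _ φ => PosTC b φ
  | b, .all _ φ => PosTC b φ
  | b, .tc _ _ φ _ _ => b = true ∧ PosTC b φ
  | _, _ => True

/-- The formula contains no transitive closure operator (pure first-order). -/
def TCFree {k : ℕ} : TForm Sig rank k → Prop
  | .not φ => TCFree φ
  | .and φ ψ => TCFree φ ∧ TCFree ψ
  | .or φ ψ => TCFree φ ∧ TCFree ψ
  | .ex _ φ => TCFree φ
  | .all _ φ => TCFree φ
  | .tc _ _ _ _ _ => False
  | _ => True

/-- The tree language defined by a (closed) formula. -/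
def treesOf {k : ℕ} (φ : TForm Sig rank k) : Set (RTree Sig rank) :=
  {t | Sat t φ fun _ => rootPos t}

/-- `FO+DTC^k`: tree languages definable by closed first-order formulas with `k`-ary
deterministic transitive closure. -/
def FODTC (Sig : Type) (rank : Sig → ℕ) (k : ℕ) : Set (Set (RTree Sig rank)) :=
  {L | ∃ φ : TForm Sig rank k, WF φ ∧ DetTC φ ∧ freeVars φ = ∅ ∧ L = treesOf φ}

/-- `FO+TC^k`: tree languages definable by closed first-order formulas with `k`-ary
transitive closure. -/
def FOTC (Sig : Type) (rank : Sig → ℕ) (k : ℕ) : Set (Set (RTree Sig rank)) :=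
  {L | ∃ φ : TForm Sig rank k, WF φ ∧ freeVars φ = ∅ ∧ L = treesOf φ}

/-- `FO+posTC^k`: tree languages definable by closed first-order formulas in which
every occurrence of the `k`-ary transitive closure operator is positive. -/
def FOposTC (Sig : Type) (rank : Sig → ℕ) (k : ℕ) : Set (Set (RTree Sig rank)) :=
  {L | ∃ φ : TForm Sig rank k, WF φ ∧ PosTC true φ ∧ freeVars φ = ∅ ∧ L = treesOf φ}

/-!  ### k-head tree-walking automata with nested pebbles  -/

/-- Tests of a `k`-head tree-walking automaton with pebble set `X`:
label of the node under head `i`, presence of pebble `x` at head `i`, and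
child number of the node under head `i`. -/
inductive TTest (Sig : Type) (k : ℕ) (X : Type) : Type
  | lab (i : Fin k) (a : Sig)
  | peb (i : Fin k) (x : X)
  | chno (i : Fin k) (j : ℕ)

/-- Instructions: move head `i` up / down to the `j`-th child (1-based), drop a
pebble at head `i`, retrieve the most recently dropped pebble (from a distance),
or perform a positive (`b = true`) or negated (`b = false`) test. -/
inductive TInstr (Sig : Type) (k : ℕ) (X : Type) : Type
  | up (i : Fin k)
  | down (i : Fin k) (j : ℕ)
  | dropPeb (i : Fin k) (x : X)
  | retrieve (x : X)
  | test (b : Bool) (τ : TTest Sig k X)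

/-- A `k`-head tree-walking automaton with nested pebbles: a finite state set `Q`,
a finite pebble set `X`, an initial state, accepting states, and a finite set of
instructions `⟨p, χ, q⟩`. -/
structure TWA (Sig : Type) (rank : Sig → ℕ) (k : ℕ) : Type 1 where
  Q : Type
  finQ : Fintype Q
  X : Type
  finX : Fintype X
  q0 : Q
  acc : Set Q
  instr : Set (Q × TInstr Sig k X × Q)
  instrFin : instr.Finite

/-- Configurations: a state, the positions of the `k` heads, and the stack of
dropped pebbles with their positions (most recent first). -/
abbrev TConf {Sig : Type} {rank : Sig → ℕ} {k : ℕ} (A : TWA Sig rank k)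
    (t : RTree Sig rank) : Type :=
  A.Q × (Fin k → Pos t) × List (A.X × Pos t)

/-- Semantics of tests. -/
def testHolds {k : ℕ} (t : RTree Sig rank) {X : Type} (τ : TTest Sig k X)
    (hs : Fin k → Pos t) (π : List (X × Pos t)) : Prop :=
  match τ with
  | .lab i a => labelAt t (hs i).1 = some a
  | .peb i x => (x, hs i) ∈ π
  | .chno i j => childNo (hs i).1 = j

/-- Semantics of a single instruction, relating head positions and pebble stacks
before and after. -/
def instrStep {k : ℕ} (t : RTree Sig rank) {X : Type} (ins : TInstr Sig k X)
    (hs : Fin k → Pos t) (π : List (X × Pos t))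
    (hs' : Fin k → Pos t) (π' : List (X × Pos t)) : Prop :=
  match ins with
  | .up i => π' = π ∧ (∃ j : ℕ, (hs i).1 = (hs' i).1 ++ [j]) ∧ ∀ h, h ≠ i → hs' h = hs h
  | .down i j => π' = π ∧ 1 ≤ j ∧ (hs' i).1 = (hs i).1 ++ [j - 1] ∧ ∀ h, h ≠ i → hs' h = hs h
  | .dropPeb i x => hs' = hs ∧ π' = (x, hs i) :: π ∧ ∀ w, (x, w) ∉ π
  | .retrieve x => hs' = hs ∧ ∃ w, π = (x, w) :: π'
  | .test b τ => hs' = hs ∧ π' = π ∧ (testHolds t τ hs π ↔ b = true)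

/-- The step relation of automaton `A` on tree `t`. -/
def Step {k : ℕ} (A : TWA Sig rank k) (t : RTree Sig rank) :
    TConf A t → TConf A t → Prop :=
  fun c c' => ∃ ins : TInstr Sig k A.X,
    (c.1, ins, c'.1) ∈ A.instr ∧ instrStep t ins c.2.1 c.2.2 c'.2.1 c'.2.2

/-- `χ'` is the negation of the test `χ`. -/
def negOf {k : ℕ} {X : Type} (χ χ' : TInstr Sig k X) : Prop :=
  ∃ b τ, χ = TInstr.test b τ ∧ χ' = TInstr.test (!b) τ

/-- Determinism: any two distinct instructions with the same source state consist
of a test and its negation. -/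
def Deterministic {k : ℕ} (A : TWA Sig rank k) : Prop :=
  ∀ p χ₁ q₁ χ₂ q₂, (p, χ₁, q₁) ∈ A.instr → (p, χ₂, q₂) ∈ A.instr →
    (χ₁, q₁) ≠ (χ₂, q₂) → negOf χ₁ χ₂ ∨ negOf χ₂ χ₁

/-- The initial configuration: initial state, all heads at the root, no pebbles. -/
def initConf {k : ℕ} (A : TWA Sig rank k) (t : RTree Sig rank) : TConf A t :=
  (A.q0, fun _ => rootPos t, [])

/-- A configuration is halting if no step is possible from it. -/
def HaltingConf {k : ℕ} (A : TWA Sig rank k) (t : RTree Sig rank) (c : TConf A t) : Prop :=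
  ∀ c', ¬ Step A t c c'

/-- Acceptance: some computation from the initial configuration halts in an
accepting state with all heads at the root and no pebbles on the tree. -/
def Accepts {k : ℕ} (A : TWA Sig rank k) (t : RTree Sig rank) : Prop :=
  ∃ q ∈ A.acc,
    Relation.ReflTransGen (Step A t) (initConf A t) (q, fun _ => rootPos t, []) ∧
    HaltingConf A t (q, fun _ => rootPos t, [])

/-- The tree language accepted by `A`. -/
def Lang {k : ℕ} (A : TWA Sig rank k) : Set (RTree Sig rank) := {t | Accepts A t}

/-- The automaton uses no pebbles at all. -/
def PebbleFree {k : ℕ} (A : TWA Sig rank k) : Prop :=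
  ∀ p χ q, (p, χ, q) ∈ A.instr →
    (∀ i x, χ ≠ TInstr.dropPeb i x) ∧ (∀ x, χ ≠ TInstr.retrieve x) ∧
    (∀ b i x, χ ≠ TInstr.test b (TTest.peb i x))

/-- `DPTWA^k`: tree languages accepted by deterministic `k`-head tree-walking
automata with nested pebbles. -/
def DPTWA (Sig : Type) (rank : Sig → ℕ) (k : ℕ) : Set (Set (RTree Sig rank)) :=
  {L | ∃ A : TWA Sig rank k, Deterministic A ∧ L = Lang A}

/-- `NPTWA^k`: tree languages accepted by nondeterministic `k`-head tree-walking
automata with nested pebbles. -/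
def NPTWA (Sig : Type) (rank : Sig → ℕ) (k : ℕ) : Set (Set (RTree Sig rank)) :=
  {L | ∃ A : TWA Sig rank k, L = Lang A}

/-- `NTWA^k`: tree languages accepted by nondeterministic `k`-head tree-walking
automata without pebbles. -/
def NTWA (Sig : Type) (rank : Sig → ℕ) (k : ℕ) : Set (Set (RTree Sig rank)) :=
  {L | ∃ A : TWA Sig rank k, PebbleFree A ∧ L = Lang A}

end NestedPebbles

namespace NestedPebbles
section Logic
variable {Sig : Type} {rank : Sig → ℕ} {k : ℕ}

theorem updVec_at {α : Type} {k : ℕ} (ν : ℕ → α) (xs : Fin k → ℕ) (a : Fin k → α)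
    (hx : Function.Injective xs) (i : Fin k) : updVec ν xs a (xs i) = a i := by
  have h : ∃ j, xs j = xs i := ⟨i, rfl⟩
  rw [updVec, dif_pos h]
  exact congrArg a (hx h.choose_spec)

theorem updVec_off {α : Type} {k : ℕ} (ν : ℕ → α) (xs : Fin k → ℕ) (a : Fin k → α)
    (n : ℕ) (hx : ∀ i, xs i ≠ n) : updVec ν xs a n = ν n := by
  rw [updVec, dif_neg]
  rintro ⟨i, hi⟩
  exact hx i hi

/-- A family of relations on the nodes of trees (in context `V`) is definable in FO+DTC. -/
def Dfn (k : ℕ) {V : Type} (R : ∀ t : RTree Sig rank, (V → Pos t) → Prop) : Prop :=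
  ∀ e : V → ℕ, ∃ φ : TForm Sig rank k, WF φ ∧ DetTC φ ∧ freeVars φ ⊆ Set.range e ∧
    ∀ (t : RTree Sig rank) (ν : ℕ → Pos t), Sat t φ ν ↔ R t (fun x => ν (e x))

variable {V W : Type}

theorem Dfn.congr {R S : ∀ t : RTree Sig rank, (V → Pos t) → Prop} (h : Dfn k R)
    (hRS : ∀ t v, S t v ↔ R t v) : Dfn k S := by
  intro e
  obtain ⟨φ, h1, h2, h3, h4⟩ := h e
  exact ⟨φ, h1, h2, h3, fun t ν => (h4 t ν).trans (hRS _ _).symm⟩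

theorem Dfn.subst {R : ∀ t : RTree Sig rank, (V → Pos t) → Prop} (h : Dfn k R) (f : V → W) :
    Dfn k (fun t (v : W → Pos t) => R t (fun x => v (f x))) := by
  intro e
  obtain ⟨φ, h1, h2, h3, h4⟩ := h (fun x => e (f x))
  refine ⟨φ, h1, h2, h3.trans ?_, h4⟩
  rintro _ ⟨x, rfl⟩
  exact ⟨f x, rfl⟩

theorem Dfn.not {R : ∀ t : RTree Sig rank, (V → Pos t) → Prop} (h : Dfn k R) :
    Dfn k (fun t v => ¬ R t v) := by
  intro e
  obtain ⟨φ, h1, h2, h3, h4⟩ := h e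
  exact ⟨.not φ, h1, h2, h3, fun t ν => not_congr (h4 t ν)⟩

theorem Dfn.and {R S : ∀ t : RTree Sig rank, (V → Pos t) → Prop} (h : Dfn k R) (h' : Dfn k S) :
    Dfn k (fun t v => R t v ∧ S t v) := by
  intro e
  obtain ⟨φ, h1, h2, h3, h4⟩ := h e
  obtain ⟨ψ, g1, g2, g3, g4⟩ := h' e
  exact ⟨.and φ ψ, ⟨h1, g1⟩, ⟨h2, g2⟩, Set.union_subset h3 g3,
    fun t ν => and_congr (h4 t ν) (g4 t ν)⟩

theorem Dfn.or {R S : ∀ t : RTree Sig rank, (V → Pos t) → Prop} (h : Dfn k R) (h' : Dfn k S) :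
    Dfn k (fun t v => R t v ∨ S t v) := by
  intro e
  obtain ⟨φ, h1, h2, h3, h4⟩ := h e
  obtain ⟨ψ, g1, g2, g3, g4⟩ := h' e
  exact ⟨.or φ ψ, ⟨h1, g1⟩, ⟨h2, g2⟩, Set.union_subset h3 g3,
    fun t ν => or_congr (h4 t ν) (g4 t ν)⟩

theorem Dfn.true : Dfn k (fun (t : RTree Sig rank) (_ : V → Pos t) => True) := by
  intro e
  refine ⟨.ex 0 (.eq 0 0), trivial, trivial, ?_, ?_⟩
  · simp [freeVars]
  · intro t ν
    simp only [Sat, iff_true]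
    exact ⟨rootPos t, trivial⟩

theorem Dfn.const (P : Prop) : Dfn k (fun (t : RTree Sig rank) (_ : V → Pos t) => P) := by
  by_cases h : P
  · exact Dfn.true.congr (by simp [h])
  · exact Dfn.true.not.congr (by simp [h])

theorem Dfn.exFin {ι : Type} [Finite ι] {R : ι → ∀ t : RTree Sig rank, (V → Pos t) → Prop}
    (h : ∀ i, Dfn k (R i)) : Dfn k (fun t v => ∃ i, R i t v) := by
  have key : ∀ l : List ι, Dfn k (fun t v => ∃ i ∈ l, R i t v) := by
    intro l
    induction l with
    | nil => exact (Dfn.const False).congr (by simp)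
    | cons a l ih => exact ((h a).or ih).congr (by simp)
  have := Fintype.ofFinite ι
  exact (key Finset.univ.toList).congr (by simp)

theorem Dfn.allFin {ι : Type} [Finite ι] {R : ι → ∀ t : RTree Sig rank, (V → Pos t) → Prop}
    (h : ∀ i, Dfn k (R i)) : Dfn k (fun t v => ∀ i, R i t v) :=
  (Dfn.exFin (fun i => (h i).not)).not.congr (by simp)

theorem Dfn.lab (a : Sig) (x : V) :
    Dfn k (fun (t : RTree Sig rank) v => labelAt t (v x).1 = some a) := fun e =>
  ⟨.lab a (e x), trivial, trivial, by simp [freeVars], fun _ _ => Iff.rfl⟩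

theorem Dfn.edg (i : ℕ) (x y : V) :
    Dfn k (fun (_ : RTree Sig rank) v => 1 ≤ i ∧ (v y).1 = (v x).1 ++ [i - 1]) := fun e =>
  ⟨.edg i (e x) (e y), trivial, trivial, by
    simp [freeVars, Set.insert_subset_iff], fun _ _ => Iff.rfl⟩

theorem Dfn.eq (x y : V) :
    Dfn k (fun (_ : RTree Sig rank) v => v x = v y) := fun e =>
  ⟨.eq (e x) (e y), trivial, trivial, by
    simp [freeVars, Set.insert_subset_iff], fun _ _ => Iff.rfl⟩

theorem Dfn.ex [Finite V] {R : ∀ t : RTree Sig rank, (Option V → Pos t) → Prop} (h : Dfn k R) :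
    Dfn k (fun t v => ∃ u, R t (fun o => o.elim u v)) := by
  intro e
  obtain ⟨n, hn⟩ := (Set.finite_range e).exists_notMem
  obtain ⟨φ, h1, h2, h3, h4⟩ := h (fun o => o.elim n e)
  refine ⟨.ex n φ, h1, h2, ?_, ?_⟩
  · rintro m ⟨hm, hmn⟩
    obtain ⟨o, rfl⟩ := h3 hm
    cases o with
    | none => exact absurd rfl hmn
    | some x => exact ⟨x, rfl⟩
  · intro t ν
    refine exists_congr fun u => ?_
    rw [h4]
    refine iff_of_eq (congrArg _ (funext fun o => ?_))
    cases o with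
    | none => simp
    | some x =>
      have : e x ≠ n := fun hx => hn ⟨x, hx⟩
      simp [this]

theorem Dfn.all [Finite V] {R : ∀ t : RTree Sig rank, (Option V → Pos t) → Prop} (h : Dfn k R) :
    Dfn k (fun t v => ∀ u, R t (fun o => o.elim u v)) :=
  h.not.ex.not.congr (by simp)

theorem Dfn.exVec (m : ℕ) : ∀ {V : Type} [Finite V]
    {R : ∀ t : RTree Sig rank, (V ⊕ Fin m → Pos t) → Prop} (_ : Dfn k R),
    Dfn k (fun t v => ∃ h : Fin m → Pos t, R t (Sum.elim v h)) := by
  induction m with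
  | zero =>
    intro V _ R h e
    obtain ⟨φ, h1, h2, h3, h4⟩ := h (Sum.elim e Fin.elim0)
    refine ⟨φ, h1, h2, h3.trans ?_, ?_⟩
    · rintro _ ⟨x | x, rfl⟩
      · exact ⟨x, rfl⟩
      · exact x.elim0
    · intro t ν
      rw [h4]
      have : ∀ g : Fin 0 → Pos t, (fun x => ν (Sum.elim e Fin.elim0 x)) =
          Sum.elim (fun x => ν (e x)) g := by
        intro g
        funext x
        rcases x with x | x
        · rfl
        · exact x.elim0
      constructor
      · intro hh
        refine ⟨Fin.elim0, ?_⟩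
        rw [← this]
        exact hh
      · rintro ⟨g, hg⟩
        rw [this g]
        exact hg
  | succ m ih =>
    intro V _ R h
    have h1 := h.subst (W := Option V ⊕ Fin m) (Sum.elim (fun x => Sum.inl (some x))
      (fun i => Fin.cases (Sum.inl none) (fun j => Sum.inr j) i))
    refine (ih h1).ex.congr ?_
    intro t v
    have key : ∀ (u : Pos t) (g : Fin m → Pos t),
        (fun x => Sum.elim (fun o : Option V => o.elim u v) g
          (Sum.elim (fun x => Sum.inl (some x))
            (fun i => Fin.cases (Sum.inl none) (fun j => Sum.inr j) i : Fin (m+1) → _) x)) =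
        Sum.elim v (Fin.cons u g : Fin (m+1) → Pos t) := by
      intro u g
      funext x
      rcases x with x | x
      · rfl
      · refine Fin.cases ?_ (fun j => ?_) x <;> rfl
    constructor
    · rintro ⟨g, hg⟩
      refine ⟨g 0, Fin.tail g, ?_⟩
      rw [key, Fin.cons_self_tail]
      exact hg
    · rintro ⟨u, g, hg⟩
      rw [key] at hg
      exact ⟨_, hg⟩

theorem freshVec (s : Set ℕ) (hs : s.Finite) (k : ℕ) :
    ∃ xs ys : Fin k → ℕ, Distinct2 xs ys ∧ (∀ i, xs i ∉ s) ∧ ∀ i, ys i ∉ s := by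
  obtain ⟨n, hn⟩ := hs.bddAbove
  refine ⟨fun i => n + 1 + i, fun i => n + 1 + k + i, ⟨?_, ?_, ?_⟩, ?_, ?_⟩
  · intro i j h
    simp at h
    omega
  · intro i j h
    simp at h
    omega
  · intro i j h
    have := i.2
    simp only at h
    omega
  · intro i h
    have := hn h
    simp only at this
    omega
  · intro i h
    have := hn h
    simp only at this
    omega

/-- a formula whose free variables are exactly a given list, always true -/
theorem dummy (l : List ℕ) : ∃ φ : TForm Sig rank k, WF φ ∧ DetTC φ ∧ freeVars φ = {x | x ∈ l} ∧
    ∀ (t : RTree Sig rank) (ν : ℕ → Pos t), Sat t φ ν := by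
  induction l with
  | nil =>
    refine ⟨.ex 0 (.eq 0 0), trivial, trivial, ?_, ?_⟩
    · simp [freeVars]
    · intro t ν
      exact ⟨rootPos t, rfl⟩
  | cons a l ih =>
    obtain ⟨φ, h1, h2, h3, h4⟩ := ih
    refine ⟨.and (.eq a a) φ, ⟨trivial, h1⟩, ⟨trivial, h2⟩, ?_, fun t ν => ⟨rfl, h4 t ν⟩⟩
    ext x
    simp [freeVars, h3]

theorem Dfn.tc [Finite V]
    {R : ∀ t : RTree Sig rank, (V ⊕ (Fin k ⊕ Fin k) → Pos t) → Prop} (h : Dfn k R)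
    (hf : ∀ t v a b b', R t (Sum.elim v (Sum.elim a b)) → R t (Sum.elim v (Sum.elim a b')) → b = b')
    (us vs : Fin k → V) :
    Dfn k (fun t v => Relation.ReflTransGen (fun a b => R t (Sum.elim v (Sum.elim a b)))
      (fun i => v (us i)) (fun i => v (vs i))) := by
  intro e
  obtain ⟨xs, ys, hd, hxs, hys⟩ := freshVec _ (Set.finite_range e) k
  obtain ⟨φ, h1, h2, h3, h4⟩ := h (Sum.elim e (Sum.elim xs ys))
  obtain ⟨ψ, g1, g2, g3, g4⟩ := dummy (Sig := Sig) (rank := rank) (k := k)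
    (List.ofFn xs ++ List.ofFn ys)
  have key : ∀ (t : RTree Sig rank) (ν : ℕ → Pos t) a b,
      Sat t (.and φ ψ) (updVec (updVec ν xs a) ys b) ↔
      R t (Sum.elim (fun x => ν (e x)) (Sum.elim a b)) := by
    intro t ν a b
    simp only [Sat, g4, and_true, h4]
    refine iff_of_eq (congrArg _ (funext fun o => ?_))
    rcases o with o | o | o
    · simp only [Sum.elim_inl]
      rw [updVec_off, updVec_off]
      · exact fun i hi => hxs i ⟨o, hi.symm⟩
      · exact fun i hi => hys i ⟨o, hi.symm⟩
    · simp only [Sum.elim_inl, Sum.elim_inr]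
      rw [updVec_off, updVec_at _ _ _ hd.1]
      exact fun i hi => hd.2.2 o i hi.symm
    · simp only [Sum.elim_inr]
      rw [updVec_at _ _ _ hd.2.1]
  refine ⟨.tc xs ys (.and φ ψ) (fun i => e (us i)) (fun i => e (vs i)), ⟨hd, ?_, h1, g1⟩,
    ⟨?_, h2, g2⟩, ?_, ?_⟩
  · intro x hx
    right
    rw [g3]
    simpa [List.mem_ofFn] using hx
  · intro t ν a b b' hb hb'
    rw [key] at hb hb'
    exact hf _ _ _ _ _ hb hb'
  · rintro x ((⟨hx | hx, hx'⟩ | ⟨i, rfl⟩) | ⟨i, rfl⟩)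
    · obtain ⟨o | o | o, rfl⟩ := h3 hx
      · exact ⟨o, rfl⟩
      · exact absurd (Or.inl ⟨o, rfl⟩) hx'
      · exact absurd (Or.inr ⟨o, rfl⟩) hx'
    · exfalso
      apply hx'
      rw [g3] at hx
      simpa [List.mem_ofFn] using hx
    · exact ⟨_, rfl⟩
    · exact ⟨_, rfl⟩
  · intro t ν
    simp only [Sat] at key ⊢
    simp only [key]

end Logic
end NestedPebbles

namespace NestedPebbles
section Kleene
variable {Sig : Type} {rank : Sig → ℕ} {k : ℕ}

/-- Nonempty paths all of whose intermediate states are in `l`. -/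
inductive KPath {Q H : Type} (R : Q × H → Q × H → Prop) (l : List Q) : Q × H → Q × H → Prop
  | single {a b} : R a b → KPath R l a b
  | step {a b c} : R a b → b.1 ∈ l → KPath R l b c → KPath R l a c

theorem KPath.functional {Q H : Type} {R : Q × H → Q × H → Prop} {l : List Q}
    (hR : ∀ a b c, R a b → R a c → b = c) {a b : Q × H} (h : KPath R l a b) :
    b.1 ∉ l → ∀ c, KPath R l a c → c.1 ∉ l → b = c := by
  induction h with
  | single h =>
    intro hb c hc hcl
    cases hc with
    | single h' => exact hR _ _ _ h h'
    | step h' hm _ =>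
      have := hR _ _ _ h h'
      subst this
      exact absurd hm hb
  | step h hm _ ih =>
    intro hb c hc hcl
    cases hc with
    | single h' =>
      have := hR _ _ _ h h'
      subst this
      exact absurd hm hcl
    | step h' hm' h2 =>
      have := hR _ _ _ h h'
      subst this
      exact ih hb c h2 hcl

theorem KPath.mono {Q H : Type} {R : Q × H → Q × H → Prop} {l l' : List Q}
    (hl : ∀ x ∈ l, x ∈ l') {a b : Q × H} (h : KPath R l a b) : KPath R l' a b := by
  induction h with
  | single h => exact .single h
  | step h hm _ ih => exact .step h (hl _ hm) ih

theorem KPath.trans {Q H : Type} {R : Q × H → Q × H → Prop} {l : List Q}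
    {a b c : Q × H} (h : KPath R l a b) (hb : b.1 ∈ l) (h' : KPath R l b c) : KPath R l a c := by
  induction h with
  | single h => exact .step h hb h'
  | step h hm _ ih => exact .step h hm (ih hb h')

theorem KPath.cons_iff {Q H : Type} {R : Q × H → Q × H → Prop} {l : List Q} {r : Q}
    (a b : Q × H) : KPath R (r :: l) a b ↔ KPath R l a b ∨ ∃ h1 h2, KPath R l a (r, h1) ∧
      Relation.ReflTransGen (fun x y => KPath R l (r, x) (r, y)) h1 h2 ∧ KPath R l (r, h2) b := by
  have hl : ∀ x ∈ l, x ∈ r :: l := fun x hx => List.mem_cons_of_mem _ hx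
  constructor
  · intro h
    induction h with
    | single h => exact Or.inl (.single h)
    | @step a b c h hm h' ih =>
      rcases List.mem_cons.1 hm with hm | hm
      · obtain ⟨q, b⟩ := b
        simp only at hm
        subst hm
        right
        rcases ih with ih | ⟨h1, h2, i1, i2, i3⟩
        · exact ⟨b, b, .single h, .refl, ih⟩
        · exact ⟨b, h2, .single h, .head i1 i2, i3⟩
      · rcases ih with ih | ⟨h1, h2, i1, i2, i3⟩
        · exact Or.inl (.step h hm ih)
        · exact Or.inr ⟨h1, h2, .step h hm i1, i2, i3⟩
  · rintro (h | ⟨h1, h2, i1, i2, i3⟩)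
    · exact h.mono hl
    · refine (i1.mono hl).trans (by simp) ?_
      clear i1
      induction i2 using Relation.ReflTransGen.head_induction_on with
      | refl => exact i3.mono hl
      | head h _ ih => exact (h.mono hl).trans (by simp) ih

theorem KPath.nil_iff {Q H : Type} {R : Q × H → Q × H → Prop}
    (a b : Q × H) : KPath R [] a b ↔ R a b := by
  constructor
  · intro h
    cases h with
    | single h => exact h
    | step _ h _ => simp at h
  · exact .single

theorem KPath.rtg_iff {Q H : Type} {R : Q × H → Q × H → Prop} {l : List Q} (hl : ∀ q, q ∈ l)
    (a b : Q × H) : Relation.ReflTransGen R a b ↔ a = b ∨ KPath R l a b := by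
  constructor
  · intro h
    induction h using Relation.ReflTransGen.head_induction_on with
    | refl => exact Or.inl rfl
    | head h _ ih =>
      right
      rcases ih with rfl | ih
      · exact .single h
      · exact .step h (hl _) ih
  · rintro (rfl | h)
    · exact .refl
    · induction h with
      | single h => exact .single h
      | step h _ _ ih => exact .head h ih

variable {V Q : Type} [Finite V]

/-- Closure of definability under the Kleene state elimination for functional relations. -/
theorem Dfn.kpath
    (R : ∀ t : RTree Sig rank, (V → Pos t) → Q × (Fin k → Pos t) → Q × (Fin k → Pos t) → Prop)
    (hf : ∀ t v a b c, R t v a b → R t v a c → b = c)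
    (hd : ∀ p q, Dfn k (fun t (v : V ⊕ (Fin k ⊕ Fin k) → Pos t) =>
      R t (fun x => v (.inl x)) (p, fun i => v (.inr (.inl i))) (q, fun i => v (.inr (.inr i)))))
    (l : List Q) (hl : l.Nodup) :
    ∀ p q, Dfn k (fun t (v : V ⊕ (Fin k ⊕ Fin k) → Pos t) =>
      KPath (R t (fun x => v (.inl x))) l
        (p, fun i => v (.inr (.inl i))) (q, fun i => v (.inr (.inr i)))) := by
  induction l with
  | nil =>
    intro p q
    exact (hd p q).congr (fun t v => KPath.nil_iff _ _)
  | cons r l ih =>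
    have hr := (List.nodup_cons.1 hl).1
    have ih := ih (List.nodup_cons.1 hl).2
    intro p q
    have htc := fun (us vs : Fin k → (V ⊕ (Fin k ⊕ Fin k)) ⊕ Fin k ⊕ Fin k) => 
      Dfn.tc ((ih r r).subst (W := ((V ⊕ (Fin k ⊕ Fin k)) ⊕ Fin k ⊕ Fin k) ⊕ (Fin k ⊕ Fin k))
        (Sum.elim (fun x => .inl (.inl (.inl x))) .inr)) (by
        intro t v a b b' hb hb'
        simp only [Sum.elim_inl, Sum.elim_inr] at hb hb'
        have := KPath.functional (hf t _) hb hr _ hb' hr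
        exact (Prod.mk.inj this).2) us vs
    have h1 := (ih p r).subst (W := (V ⊕ (Fin k ⊕ Fin k)) ⊕ Fin k ⊕ Fin k)
      (Sum.elim (fun x => .inl (.inl x))
        (Sum.elim (fun i => .inl (.inr (.inl i))) (fun i => .inr (.inl i))))
    have h3 := (ih r q).subst (W := (V ⊕ (Fin k ⊕ Fin k)) ⊕ Fin k ⊕ Fin k)
      (Sum.elim (fun x => .inl (.inl x))
        (Sum.elim (fun i => .inr (.inr i)) (fun i => .inl (.inr (.inr i)))))
    have h2 := htc (fun i => .inr (.inl i)) (fun i => .inr (.inr i))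
    have h4 := ((h1.and (h2.and h3)).subst (W := ((V ⊕ (Fin k ⊕ Fin k)) ⊕ Fin k) ⊕ Fin k)
      (Sum.elim (fun x => .inl (.inl x)) (Sum.elim (fun x => .inl (.inr x)) .inr)))
    refine ((ih p q).or (Dfn.exVec k (Dfn.exVec k h4))).congr ?_
    intro t v
    rw [KPath.cons_iff]
    rfl

theorem Dfn.rtg [Finite Q]
    (R : ∀ t : RTree Sig rank, (V → Pos t) → Q × (Fin k → Pos t) → Q × (Fin k → Pos t) → Prop)
    (hf : ∀ t v a b c, R t v a b → R t v a c → b = c)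
    (hd : ∀ p q, Dfn k (fun t (v : V ⊕ (Fin k ⊕ Fin k) → Pos t) =>
      R t (fun x => v (.inl x)) (p, fun i => v (.inr (.inl i))) (q, fun i => v (.inr (.inr i)))))
    (p q : Q) : Dfn k (fun t (v : V ⊕ (Fin k ⊕ Fin k) → Pos t) =>
      Relation.ReflTransGen (R t (fun x => v (.inl x)))
        (p, fun i => v (.inr (.inl i))) (q, fun i => v (.inr (.inr i)))) := by
  have := Fintype.ofFinite Q
  have h1 := Dfn.kpath R hf hd Finset.univ.toList (Finset.nodup_toList _) p q
  have h2 : Dfn k (fun (t : RTree Sig rank) (v : V ⊕ (Fin k ⊕ Fin k) → Pos t) =>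
    p = q ∧ ∀ i : Fin k, v (.inr (.inl i)) = v (.inr (.inr i))) :=
    (Dfn.const _).and (Dfn.allFin fun i => Dfn.eq _ _)
  refine (h2.or h1).congr ?_
  intro t v
  rw [KPath.rtg_iff (l := Finset.univ.toList) (by simp)]
  simp only [Prod.mk.injEq, funext_iff]

end Kleene
end NestedPebbles

namespace NestedPebbles
section TreeFacts
variable {Sig : Type} {rank : Sig → ℕ} {k : ℕ}

theorem subtree_append (t : RTree Sig rank) (p q : List ℕ) :
    t.subtree (p ++ q) = (t.subtree p).bind (fun s => s.subtree q) := by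
  induction p generalizing t with
  | nil => simp [RTree.subtree]
  | cons i p ih =>
    simp only [List.cons_append, RTree.subtree]
    cases t.child i with
    | none => rfl
    | some s => simpa using ih s

theorem isPos_initial {t : RTree Sig rank} {p q : List ℕ} (h : IsPos t (p ++ q)) : IsPos t p := by
  unfold IsPos at *
  rw [subtree_append] at h
  cases hs : t.subtree p with
  | none => simp [hs] at h
  | some s => rfl

theorem isPos_snoc {t : RTree Sig rank} {p : List ℕ} {j : ℕ} {a : Sig}
    (ha : labelAt t p = some a) : IsPos t (p ++ [j]) ↔ j < rank a := by
  unfold labelAt at ha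
  unfold IsPos
  rw [subtree_append]
  cases hs : t.subtree p with
  | none => simp [hs] at ha
  | some s =>
    obtain ⟨b, c⟩ := s
    simp only [hs, Option.map_some, RTree.label, Option.some.injEq] at ha
    subst ha
    by_cases hj : j < rank b <;> simp [RTree.subtree, RTree.child, hj]

theorem exists_label (t : RTree Sig rank) (p : Pos t) : ∃ a, labelAt t p.1 = some a := by
  obtain ⟨s, hs⟩ := Option.isSome_iff_exists.1 p.2
  exact ⟨s.label, by simp [labelAt, hs]⟩

theorem childNo_nil : childNo [] = 0 := rfl

theorem childNo_snoc (p : List ℕ) (j : ℕ) : childNo (p ++ [j]) = j + 1 := by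
  simp [childNo]

theorem childNo_eq_zero {p : List ℕ} : childNo p = 0 ↔ p = [] := by
  rcases List.eq_nil_or_concat p with rfl | ⟨q, j, rfl⟩
  · simp [childNo_nil]
  · simp [childNo_snoc]

theorem childNo_eq_succ {p : List ℕ} {j : ℕ} : childNo p = j + 1 ↔ ∃ q, p = q ++ [j] := by
  rcases List.eq_nil_or_concat p with rfl | ⟨q, i, rfl⟩
  · simp [childNo_nil]
  · simp only [List.concat_eq_append, childNo_snoc]
    simp

/-- A bound on the ranks. -/
theorem exists_bound (Sig : Type) [Finite Sig] (rank : Sig → ℕ) : ∃ B, ∀ a, rank a < B := by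
  have := Fintype.ofFinite Sig
  refine ⟨(Finset.univ.sup rank) + 1, fun a => Nat.lt_succ_of_le (Finset.le_sup (Finset.mem_univ a))⟩

theorem snoc_lt {B : ℕ} (hB : ∀ a, rank a < B) {t : RTree Sig rank} {p : List ℕ} {j : ℕ}
    (h : IsPos t (p ++ [j])) : j + 1 < B := by
  obtain ⟨a, ha⟩ := exists_label t ⟨p, isPos_initial h⟩
  have := (isPos_snoc ha).1 h
  have := hB a
  omega

variable {V : Type}

theorem Dfn.childOf [Finite Sig] (x y : V) :
    Dfn k (fun (_ : RTree Sig rank) v => ∃ j, (v y).1 = (v x).1 ++ [j]) := by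
  obtain ⟨B, hB⟩ := exists_bound Sig rank
  refine (Dfn.exFin (ι := Fin B) (fun j => Dfn.edg (j.1 + 1) x y)).congr ?_
  intro t v
  constructor
  · rintro ⟨j, hj⟩
    have h := (v y).2
    rw [hj] at h
    exact ⟨⟨j, by have := snoc_lt hB h; omega⟩, by simp, by simpa using hj⟩
  · rintro ⟨j, _, hj⟩
    exact ⟨_, hj⟩

theorem Dfn.chno [Finite Sig] [Finite V] (j : ℕ) (x : V) :
    Dfn k (fun (_ : RTree Sig rank) v => childNo (v x).1 = j) := by
  cases j with
  | zero =>
    refine (Dfn.ex (Dfn.childOf (V := Option V) none (some x))).not.congr ?_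
    intro t v
    rw [childNo_eq_zero]
    constructor
    · rintro h ⟨u, j, hj⟩
      simp [h] at hj
    · intro h
      by_contra hne
      obtain ⟨q, i, hq⟩ := (List.eq_nil_or_concat (v x).1).resolve_left hne
      rw [List.concat_eq_append] at hq
      have h2 := (v x).2
      rw [hq] at h2
      exact h ⟨⟨q, isPos_initial h2⟩, i, hq⟩
  | succ j =>
    refine (Dfn.ex (Dfn.edg (j + 1) (none : Option V) (some x))).congr ?_
    intro t v
    rw [childNo_eq_succ]
    constructor
    · rintro ⟨q, hq⟩
      have h2 := (v x).2
      rw [hq] at h2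
      exact ⟨⟨q, isPos_initial h2⟩, Nat.le_add_left 1 j, hq⟩
    · rintro ⟨q, _, hq⟩
      exact ⟨_, hq⟩

theorem childNo_root_iff {t : RTree Sig rank} (p : Pos t) : childNo p.1 = 0 ↔ p = rootPos t := by
  rw [childNo_eq_zero]
  exact ⟨fun h => Subtype.ext h, fun h => by rw [h]; rfl⟩

end TreeFacts

section Macro
variable {Sig : Type} {rank : Sig → ℕ} {k : ℕ}

/-- Instructions that do not change the pebble stack. -/
def isPlain {X : Type} : TInstr Sig k X → Prop
  | .dropPeb _ _ => False
  | .retrieve _ => False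
  | _ => True

/-- One step of the automaton not changing the pebble stack. -/
def Plain (A : TWA Sig rank k) (t : RTree Sig rank) (π : List (A.X × Pos t))
    (a b : A.Q × (Fin k → Pos t)) : Prop :=
  ∃ ins, isPlain ins ∧ (a.1, ins, b.1) ∈ A.instr ∧ instrStep t ins a.2 π b.2 π

/-- Macro steps: plain steps, or a drop followed by a computation above the dropped pebble
and the corresponding retrieve. -/
def Macro (A : TWA Sig rank k) (t : RTree Sig rank) :
    ℕ → List (A.X × Pos t) → A.Q × (Fin k → Pos t) → A.Q × (Fin k → Pos t) → Prop
  | 0, π, a, b => Plain A t π a b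
  | n + 1, π, a, b => Plain A t π a b ∨
      ∃ i x p q, (a.1, .dropPeb i x, p) ∈ A.instr ∧ (q, .retrieve x, b.1) ∈ A.instr ∧
        (∀ w, (x, w) ∉ π) ∧
        Relation.ReflTransGen (Macro A t n ((x, a.2 i) :: π)) (p, a.2) (q, b.2)

theorem Macro.plain {A : TWA Sig rank k} {t : RTree Sig rank} {n π a b} (h : Plain A t π a b) :
    Macro A t n π a b := by
  cases n
  · exact h
  · exact Or.inl h

theorem instrStep_functional {X : Type} {t : RTree Sig rank} {ins : TInstr Sig k X}
    {hs hs1 hs2 : Fin k → Pos t} {π π1 π2 : List (X × Pos t)}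
    (h1 : instrStep t ins hs π hs1 π1) (h2 : instrStep t ins hs π hs2 π2) :
    hs1 = hs2 ∧ π1 = π2 := by
  cases ins with
  | up i =>
    obtain ⟨a1, ⟨j1, b1⟩, c1⟩ := h1
    obtain ⟨a2, ⟨j2, b2⟩, c2⟩ := h2
    refine ⟨funext fun h => ?_, a1.trans a2.symm⟩
    by_cases hh : h = i
    · subst hh
      rw [b1] at b2
      exact Subtype.ext (List.append_inj_left' b2 rfl)
    · rw [c1 h hh, c2 h hh]
  | down i j =>
    obtain ⟨a1, _, b1, c1⟩ := h1
    obtain ⟨a2, _, b2, c2⟩ := h2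
    refine ⟨funext fun h => ?_, a1.trans a2.symm⟩
    by_cases hh : h = i
    · subst hh
      exact Subtype.ext (b1.trans b2.symm)
    · rw [c1 h hh, c2 h hh]
  | dropPeb i x =>
    exact ⟨h1.1.trans h2.1.symm, h1.2.1.trans h2.2.1.symm⟩
  | retrieve x =>
    obtain ⟨a1, w1, b1⟩ := h1
    obtain ⟨a2, w2, b2⟩ := h2
    rw [b1] at b2
    exact ⟨a1.trans a2.symm, (List.cons.inj b2).2⟩
  | test b τ => exact ⟨h1.1.trans h2.1.symm, h1.2.1.trans h2.2.1.symm⟩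

theorem test_exclusive {X : Type} {t : RTree Sig rank} {χ χ' : TInstr Sig k X}
    {hs hs1 hs2 : Fin k → Pos t} {π π1 π2 : List (X × Pos t)} (hn : negOf χ χ')
    (h1 : instrStep t χ hs π hs1 π1) (h2 : instrStep t χ' hs π hs2 π2) : False := by
  obtain ⟨b, τ, rfl, rfl⟩ := hn
  have e1 := h1.2.2
  have e2 := h2.2.2
  cases b <;> simp_all

theorem Step.functional {A : TWA Sig rank k} (hA : Deterministic A) {t : RTree Sig rank}
    {a b c : TConf A t} (h1 : Step A t a b) (h2 : Step A t a c) : b = c := by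
  obtain ⟨i1, m1, s1⟩ := h1
  obtain ⟨i2, m2, s2⟩ := h2
  by_cases he : (i1, b.1) = (i2, c.1)
  · obtain ⟨rfl, hq⟩ := Prod.mk.inj he
    obtain ⟨e1, e2⟩ := instrStep_functional s1 s2
    exact Prod.ext hq (Prod.ext e1 e2)
  · rcases hA _ _ _ _ _ m1 m2 he with hn | hn
    · exact (test_exclusive hn s1 s2).elim
    · exact (test_exclusive hn s2 s1).elim

theorem det_eq {A : TWA Sig rank k} (hA : Deterministic A) {p q1 q2 : A.Q}
    {χ1 χ2 : TInstr Sig k A.X} (hχ : ∀ b τ, χ1 ≠ .test b τ)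
    (h1 : (p, χ1, q1) ∈ A.instr) (h2 : (p, χ2, q2) ∈ A.instr) : χ1 = χ2 ∧ q1 = q2 := by
  by_contra hne
  rcases hA _ _ _ _ _ h1 h2 (fun h => hne (Prod.mk.inj h)) with ⟨b, τ, h, _⟩ | ⟨b, τ, _, h⟩
  · exact hχ _ _ h
  · exact hχ _ _ h

theorem rtg_normal_unique {α : Type} {R : α → α → Prop} (hR : ∀ a b c, R a b → R a c → b = c)
    {a b c : α} (h1 : Relation.ReflTransGen R a b) (h2 : Relation.ReflTransGen R a c)
    (hb : ∀ d, ¬ R b d) (hc : ∀ d, ¬ R c d) : b = c := by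
  induction h1 using Relation.ReflTransGen.head_induction_on with
  | refl =>
    rcases Relation.ReflTransGen.cases_head h2 with h | ⟨d, h, _⟩
    · exact h
    · exact absurd h (hb d)
  | head h _ ih =>
    rcases Relation.ReflTransGen.cases_head h2 with h' | ⟨d, h', h''⟩
    · subst h'
      exact absurd h (hc _)
    · have := hR _ _ _ h h'
      subst this
      exact ih h''

theorem Macro.no_retrieve {A : TWA Sig rank k} (hA : Deterministic A) {t : RTree Sig rank}
    {n π a b x q} (hq : (a.1, .retrieve x, q) ∈ A.instr) : ¬ Macro A t n π a b := by
  have hp : ¬ Plain A t π a b := by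
    rintro ⟨ins, hi, hm, _⟩
    obtain ⟨rfl, _⟩ := det_eq hA (by simp) hq hm
    exact hi
  cases n with
  | zero => exact hp
  | succ n =>
    rintro (h | ⟨i, y, p', q', h1, _⟩)
    · exact hp h
    · have := (det_eq hA (by simp) hq h1).1
      simp at this

theorem Plain.functional {A : TWA Sig rank k} (hA : Deterministic A) {t : RTree Sig rank}
    {π a b c} (h1 : Plain A t π a b) (h2 : Plain A t π a c) : b = c := by
  obtain ⟨i1, _, m1, s1⟩ := h1
  obtain ⟨i2, _, m2, s2⟩ := h2
  have := Step.functional hA (a := (a.1, a.2, π)) (b := (b.1, b.2, π)) (c := (c.1, c.2, π))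
    ⟨i1, m1, s1⟩ ⟨i2, m2, s2⟩
  simp only [Prod.mk.injEq] at this
  exact Prod.ext this.1 this.2.1

theorem Macro.functional {A : TWA Sig rank k} (hA : Deterministic A) (t : RTree Sig rank)
    (n : ℕ) : ∀ π a b c, Macro A t n π a b → Macro A t n π a c → b = c := by
  induction n with
  | zero => exact fun π a b c h1 h2 => Plain.functional hA h1 h2
  | succ n ih =>
    have key : ∀ π (a b c : A.Q × (Fin k → Pos t)), Plain A t π a b → (∃ i x p q, (a.1, .dropPeb i x, p) ∈ A.instr ∧
        (q, .retrieve x, c.1) ∈ A.instr ∧ (∀ w, (x, w) ∉ π) ∧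
        Relation.ReflTransGen (Macro A t n ((x, a.2 i) :: π)) (p, a.2) (q, c.2)) → False := by
      rintro π a b c ⟨ins, hi, m1, _⟩ ⟨i, x, p, q, m2, _⟩
      obtain ⟨rfl, _⟩ := det_eq hA (by simp) m2 m1
      exact hi
    rintro π a b c (h1 | h1) (h2 | h2)
    · exact Plain.functional hA h1 h2
    · exact (key _ _ _ _ h1 h2).elim
    · exact (key _ _ _ _ h2 h1).elim
    · obtain ⟨i, x, p, q, m1, m2, _, h1⟩ := h1
      obtain ⟨i', x', p', q', m1', m2', _, h2⟩ := h2
      obtain ⟨e, rfl⟩ := det_eq hA (by simp) m1 m1'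
      obtain ⟨rfl, rfl⟩ := TInstr.dropPeb.inj e
      have := rtg_normal_unique (ih _) h1 h2 (fun d => Macro.no_retrieve hA m2)
        (fun d => Macro.no_retrieve hA m2')
      obtain ⟨rfl, e2⟩ := Prod.mk.inj this
      exact Prod.ext (det_eq hA (by simp) m2 m2').2 e2

theorem Macro.sound {A : TWA Sig rank k} {t : RTree Sig rank}
    (n : ℕ) : ∀ π a b, Macro A t n π a b →
      Relation.ReflTransGen (Step A t) (a.1, a.2, π) (b.1, b.2, π) := by
  have key : ∀ π a b, Plain A t π a b →
      Relation.ReflTransGen (Step A t) (a.1, a.2, π) (b.1, b.2, π) := by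
    rintro π a b ⟨ins, _, m, s⟩
    exact .single ⟨ins, m, s⟩
  induction n with
  | zero => exact key
  | succ n ih =>
    rintro π a b (h | ⟨i, x, p, q, m1, m2, hx, h⟩)
    · exact key _ _ _ h
    · have h1 : Step A t (a.1, a.2, π) (p, a.2, (x, a.2 i) :: π) :=
        ⟨_, m1, rfl, rfl, hx⟩
      have h3 : Step A t (q, b.2, (x, a.2 i) :: π) (b.1, b.2, π) :=
        ⟨_, m2, rfl, _, rfl⟩
      have h2 : Relation.ReflTransGen (Step A t) (p, a.2, (x, a.2 i) :: π)
          (q, b.2, (x, a.2 i) :: π) :=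
        Relation.ReflTransGen.lift' (fun c : A.Q × (Fin k → Pos t) =>
          ((c.1, c.2, (x, a.2 i) :: π) : TConf A t)) (ih _) _ _ h
      exact .head h1 (h2.tail h3)

/-- The invariant of computations: the stack decomposes the computation into frames. -/
def Frames (A : TWA Sig rank k) (t : RTree Sig rank) :
    List (A.X × Pos t) → A.Q × (Fin k → Pos t) → Prop
  | [], c => Relation.ReflTransGen (Macro A t (Nat.card A.X) []) (A.q0, fun _ => rootPos t) c
  | y :: π, c => ∃ (a : A.Q × (Fin k → Pos t)) (i : Fin k) (p : A.Q), Frames A t π a ∧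
      (a.1, .dropPeb i y.1, p) ∈ A.instr ∧ a.2 i = y.2 ∧ (∀ w, (y.1, w) ∉ π) ∧
      Relation.ReflTransGen (Macro A t (Nat.card A.X - (y :: π).length) (y :: π)) (p, a.2) c

theorem Frames.nodup {A : TWA Sig rank k} {t : RTree Sig rank} : ∀ {π : List (A.X × Pos t)} {c},
    Frames A t π c → (π.map Prod.fst).Nodup
  | [], _, _ => by simp
  | y :: π, c, ⟨a, i, p, h1, _, _, h2, _⟩ => by
    rw [List.map_cons, List.nodup_cons]
    refine ⟨?_, h1.nodup⟩
    rw [List.mem_map]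
    rintro ⟨⟨x, w⟩, hm, rfl⟩
    exact h2 w hm

theorem Frames.extend {A : TWA Sig rank k} {t : RTree Sig rank} {π : List (A.X × Pos t)} {c d}
    (h : Frames A t π c) (hs : Macro A t (Nat.card A.X - π.length) π c d) : Frames A t π d := by
  cases π with
  | nil => exact Relation.ReflTransGen.tail h hs
  | cons y π =>
    obtain ⟨a, i, p, h1, h2, h3, h4, h5⟩ := h
    exact ⟨a, i, p, h1, h2, h3, h4, h5.tail hs⟩

theorem Frames.step {A : TWA Sig rank k} {t : RTree Sig rank} {c d : TConf A t}
    (h : Frames A t c.2.2 (c.1, c.2.1)) (hs : Step A t c d) : Frames A t d.2.2 (d.1, d.2.1) := by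
  obtain ⟨q, hd, π⟩ := c
  obtain ⟨q', hd', π'⟩ := d
  obtain ⟨ins, hm, hs⟩ := hs
  simp only at *
  have key : isPlain ins → π' = π → Frames A t π' (q', hd') := by
    rintro hp rfl
    exact h.extend (Macro.plain ⟨ins, hp, hm, hs⟩)
  cases ins with
  | up i => exact key trivial hs.1
  | down i j => exact key trivial hs.1
  | test b τ => exact key trivial hs.2.1
  | dropPeb i x =>
    obtain ⟨rfl, rfl, hx⟩ := hs
    exact ⟨_, i, q', h, hm, rfl, hx, .refl⟩
  | retrieve x =>
    obtain ⟨rfl, w, rfl⟩ := hs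
    have hnd := h.nodup
    obtain ⟨a, i, p, h1, h2, h3, h4, h5⟩ := h
    refine h1.extend ?_
    have hlt : π'.length < Nat.card A.X := by
      have := A.finX
      have := hnd.length_le_card
      simp only [List.map_cons, List.length_cons, List.length_map] at this
      rw [Nat.card_eq_fintype_card]
      omega
    obtain ⟨m, hm'⟩ : ∃ m, Nat.card A.X - π'.length = m + 1 := ⟨_, (Nat.succ_pred_eq_of_pos (by omega)).symm⟩
    have : Nat.card A.X - ((x, w) :: π').length = m := by
      simp only [List.length_cons]
      omega
    rw [this] at h5
    rw [hm']
    simp only at h3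
    subst h3
    exact Or.inr ⟨i, x, p, q, h2, hm, h4, h5⟩

theorem reach_iff_bigStep {A : TWA Sig rank k} {t : RTree Sig rank} (q : A.Q) (h : Fin k → Pos t) :
    Relation.ReflTransGen (Step A t) (initConf A t) (q, h, []) ↔
    Relation.ReflTransGen (Macro A t (Nat.card A.X) []) (A.q0, fun _ => rootPos t) (q, h) := by
  constructor
  · intro hr
    have : ∀ c : TConf A t, Relation.ReflTransGen (Step A t) (initConf A t) c →
        Frames A t c.2.2 (c.1, c.2.1) := by
      intro c hc
      induction hc with
      | refl => exact Relation.ReflTransGen.refl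
      | tail _ hs ih => exact ih.step hs
    exact this _ hr
  · intro hr
    exact Relation.ReflTransGen.lift' (fun c : A.Q × (Fin k → Pos t) =>
      ((c.1, c.2, []) : TConf A t)) (Macro.sound _ _) _ _ hr

end Macro
end NestedPebbles

namespace NestedPebbles
section ToLogic
variable {Sig : Type} {rank : Sig → ℕ} {k : ℕ}

/-- The stack with pebble names `s` (top first) at positions given by `g`. -/
def stk {X P : Type} (s : List X) (g : X → P) : List (X × P) := s.map fun x => (x, g x)

theorem mem_stk {X P : Type} {s : List X} {g : X → P} {x : X} {w : P} :
    (x, w) ∈ stk s g ↔ x ∈ s ∧ g x = w := by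
  simp only [stk, List.mem_map, Prod.mk.injEq]
  constructor
  · rintro ⟨y, hy, rfl, h⟩
    exact ⟨hy, h⟩
  · rintro ⟨hy, h⟩
    exact ⟨x, hy, rfl, h⟩

theorem Dfn.instr [Finite Sig] {X : Type} [Finite X] (s : List X) (ins : TInstr Sig k X)
    (hi : isPlain ins) :
    Dfn k (fun (t : RTree Sig rank) (v : X ⊕ (Fin k ⊕ Fin k) → Pos t) =>
      instrStep t ins (fun i => v (.inr (.inl i))) (stk s fun x => v (.inl x))
        (fun i => v (.inr (.inr i))) (stk s fun x => v (.inl x))) := by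
  have hoth : ∀ i : Fin k, Dfn k (fun (t : RTree Sig rank) (v : X ⊕ (Fin k ⊕ Fin k) → Pos t) =>
      ∀ h : Fin k, h ≠ i → v (.inr (.inr h)) = v (.inr (.inl h))) := by
    intro i
    refine Dfn.allFin fun h => ?_
    exact ((Dfn.const (h ≠ i)).not.or (Dfn.eq _ _)).congr (by
      intro t v
      rw [imp_iff_not_or])
  cases ins with
  | dropPeb i x => exact hi.elim
  | retrieve x => exact hi.elim
  | up i =>
    refine ((Dfn.childOf (.inr (.inr i)) (.inr (.inl i))).and (hoth i)).congr ?_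
    intro t v
    simp only [instrStep, true_and]
  | down i j =>
    refine ((Dfn.edg j (.inr (.inl i)) (.inr (.inr i))).and (hoth i)).congr ?_
    intro t v
    simp only [instrStep, true_and, and_assoc]
  | test b τ =>
    have hall : Dfn k (fun (t : RTree Sig rank) (v : X ⊕ (Fin k ⊕ Fin k) → Pos t) =>
        ∀ h : Fin k, v (.inr (.inr h)) = v (.inr (.inl h))) :=
      Dfn.allFin fun h => Dfn.eq _ _
    have hτ : Dfn k (fun (t : RTree Sig rank) (v : X ⊕ (Fin k ⊕ Fin k) → Pos t) =>
        testHolds t τ (fun i => v (.inr (.inl i))) (stk s fun x => v (.inl x))) := by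
      cases τ with
      | lab i a => exact Dfn.lab a _
      | chno i j => exact Dfn.chno j _
      | peb i x =>
        refine ((Dfn.const (x ∈ s)).and (Dfn.eq (.inl x) (.inr (.inl i)))).congr ?_
        intro t v
        exact mem_stk
    cases b with
    | true =>
      refine (hall.and hτ).congr ?_
      intro t v
      simp [instrStep, funext_iff]
    | false =>
      refine (hall.and hτ.not).congr ?_
      intro t v
      simp [instrStep, funext_iff]

theorem Dfn.plain [Finite Sig] (A : TWA Sig rank k) (s : List A.X) (p q : A.Q) :
    Dfn k (fun (t : RTree Sig rank) (v : A.X ⊕ (Fin k ⊕ Fin k) → Pos t) =>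
      Plain A t (stk s fun x => v (.inl x)) (p, fun i => v (.inr (.inl i)))
        (q, fun i => v (.inr (.inr i)))) := by
  have := A.finX
  have := A.instrFin.to_subtype
  have h : ∀ z : A.instr, Dfn k (fun (t : RTree Sig rank) (v : A.X ⊕ (Fin k ⊕ Fin k) → Pos t) =>
      (isPlain z.1.2.1 ∧ z.1.1 = p ∧ z.1.2.2 = q) ∧
      instrStep t z.1.2.1 (fun i => v (.inr (.inl i))) (stk s fun x => v (.inl x))
        (fun i => v (.inr (.inr i))) (stk s fun x => v (.inl x))) := by
    intro z
    by_cases hz : isPlain z.1.2.1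
    · exact (Dfn.const _).and (Dfn.instr s _ hz)
    · exact (Dfn.const False).congr (by simp [hz])
  refine (Dfn.exFin h).congr ?_
  intro t v
  constructor
  · rintro ⟨ins, h1, h2, h3⟩
    exact ⟨⟨_, h2⟩, ⟨h1, rfl, rfl⟩, h3⟩
  · rintro ⟨⟨⟨p', ins, q'⟩, h2⟩, ⟨h1, rfl, rfl⟩, h3⟩
    exact ⟨ins, h1, h2, h3⟩

theorem Dfn.bigStep [Finite Sig] (A : TWA Sig rank k) (hA : Deterministic A) (n : ℕ) :
    ∀ (s : List A.X) (p q : A.Q),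
    Dfn k (fun (t : RTree Sig rank) (v : A.X ⊕ (Fin k ⊕ Fin k) → Pos t) =>
      Macro A t n (stk s fun x => v (.inl x)) (p, fun i => v (.inr (.inl i)))
        (q, fun i => v (.inr (.inr i)))) := by
  classical
  have := A.finX
  have := A.finQ
  induction n with
  | zero => exact fun s p q => Dfn.plain A s p q
  | succ n ih =>
    intro s p q
    refine (Dfn.plain A s p q).or ?_
    refine Dfn.exFin fun i => Dfn.exFin fun x => Dfn.exFin fun p' => Dfn.exFin fun q' => ?_
    dsimp only
    refine (Dfn.const _).and ((Dfn.const _).and ?_)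
    by_cases hx : x ∈ s
    · refine (Dfn.const False).congr ?_
      intro t v
      simp [mem_stk, hx]
    · have h1 := (Dfn.rtg (V := A.X) (fun t v => Macro A t n (stk (x :: s) v))
        (fun t v => Macro.functional hA t n _) (ih (x :: s)) p' q').subst
        (W := A.X ⊕ (Fin k ⊕ Fin k))
        (Sum.elim (fun y => if y = x then .inr (.inl i) else .inl y) .inr)
      refine h1.congr ?_
      intro t v
      have hst : (stk (x :: s) fun y => v (if y = x then .inr (.inl i) else .inl y)) =
          (x, v (.inr (.inl i))) :: stk s fun x => v (.inl x) := by
        simp only [stk, List.map_cons, if_true, List.cons.injEq, true_and]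
        refine List.map_congr_left fun y hy => ?_
        rw [if_neg]
        rintro rfl
        exact hx hy
      simp only [Sum.elim_inl, Sum.elim_inr, hst, mem_stk, hx, false_and, not_false_iff,
        implies_true, true_and]

/-- Whether an instruction is enabled with all heads at a root labelled `a` and no pebbles. -/
def enabledAt {X : Type} (rank : Sig → ℕ) (a : Sig) : TInstr Sig k X → Prop
  | .up _ => False
  | .down _ j => 1 ≤ j ∧ j - 1 < rank a
  | .dropPeb _ _ => True
  | .retrieve _ => False
  | .test b (.lab _ a') => a = a' ↔ b = true
  | .test b (.peb _ _) => False ↔ b = true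
  | .test b (.chno _ j) => 0 = j ↔ b = true

theorem enabledAt_iff {X : Type} {t : RTree Sig rank} {a : Sig} (ha : labelAt t [] = some a)
    (ins : TInstr Sig k X) : enabledAt rank a ins ↔
      ∃ hs' π', instrStep t ins (fun _ => rootPos t) [] hs' π' := by
  cases ins with
  | up i =>
    simp only [enabledAt, false_iff]
    rintro ⟨hs', π', _, ⟨j, hj⟩, _⟩
    simp [rootPos] at hj
  | down i j =>
    constructor
    · rintro ⟨h1, h2⟩
      obtain ⟨P, hP⟩ : ∃ P : Pos t, P.1 = [] ++ [j - 1] := ⟨⟨_, (isPos_snoc ha).2 h2⟩, rfl⟩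
      refine ⟨Function.update (fun _ => rootPos t) i P, [], rfl, h1, ?_, ?_⟩
      · rw [Function.update_self, hP]
        rfl
      · intro h hh
        simp [hh]
    · rintro ⟨hs', π', _, h1, h2, _⟩
      refine ⟨h1, (isPos_snoc ha).1 ?_⟩
      have := (hs' i).2
      rw [h2] at this
      exact this
  | dropPeb i x =>
    simp only [enabledAt, true_iff]
    exact ⟨_, _, rfl, rfl, by simp⟩
  | retrieve x =>
    simp only [enabledAt, false_iff]
    rintro ⟨hs', π', _, w, hw⟩
    simp at hw
  | test b τ =>
    have h1 : (∃ hs' π', instrStep t (.test b τ) (fun _ => rootPos t) [] hs' π') ↔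
        (testHolds t τ (fun _ => rootPos t) [] ↔ b = true) :=
      ⟨fun ⟨_, _, _, _, h⟩ => h, fun h => ⟨_, _, rfl, rfl, h⟩⟩
    rw [h1]
    cases τ with
    | lab i a' =>
      have h2 : (labelAt t (rootPos t).1 = some a') ↔ a = a' := by
        rw [show labelAt t (rootPos t).1 = some a from ha, Option.some.injEq]
      simp only [enabledAt, testHolds, h2]
    | peb i x => simp [enabledAt, testHolds]
    | chno i j => exact Iff.rfl

theorem halting_iff {A : TWA Sig rank k} {t : RTree Sig rank} {a : Sig}
    (ha : labelAt t [] = some a) (q : A.Q) :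
    HaltingConf A t (q, fun _ => rootPos t, []) ↔
      ∀ ins q', (q, ins, q') ∈ A.instr → ¬ enabledAt rank a ins := by
  constructor
  · intro h ins q' hm he
    obtain ⟨hs', π', hs⟩ := (enabledAt_iff ha ins).1 he
    exact h (q', hs', π') ⟨ins, hm, hs⟩
  · rintro h ⟨q', hs', π'⟩ ⟨ins, hm, hs⟩
    exact h ins q' hm ((enabledAt_iff ha ins).2 ⟨_, _, hs⟩)

theorem DPTWA_subset [Finite Sig] : DPTWA Sig rank k ⊆ FODTC Sig rank k := by
  rintro L ⟨A, hA, rfl⟩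
  have := A.finX
  have := A.finQ
  have h1 := fun q => (Dfn.rtg (V := A.X) (fun t v => Macro A t (Nat.card A.X) (stk [] v))
        (fun t v => Macro.functional hA t _ _) (Dfn.bigStep A hA _ []) A.q0 q).subst
        (W := Option Empty) (fun _ => none)
  have h2 : Dfn k (fun (t : RTree Sig rank) (v : Option Empty → Pos t) =>
      childNo (v none).1 = 0) := Dfn.chno 0 none
  have h3 := fun q => Dfn.exFin (fun a : Sig => (Dfn.const (∀ ins q', (q, ins, q') ∈ A.instr →
      ¬ enabledAt rank a ins)).and (Dfn.lab (rank := rank) (k := k) a (none : Option Empty)))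
  have h4 := (h2.and (Dfn.exFin fun q => ((Dfn.const (q ∈ A.acc)).and ((h1 q).and (h3 q))))).ex
  obtain ⟨φ, g1, g2, g3, g4⟩ := h4 (fun x => x.elim)
  refine ⟨φ, g1, g2, ?_, ?_⟩
  · rw [Set.eq_empty_iff_forall_notMem]
    intro x hx
    obtain ⟨y, _⟩ := g3 hx
    exact y.elim
  · ext t
    refine Iff.trans ?_ (g4 t _).symm
    simp only [Lang, Accepts, Set.mem_ofPred_eq, Option.elim_none, childNo_root_iff, exists_eq_left,
      reach_iff_bigStep]
    refine exists_congr fun q => and_congr_right fun _ => and_congr_right fun _ => ?_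
    obtain ⟨a, ha⟩ := exists_label t (rootPos t)
    rw [halting_iff ha]
    constructor
    · intro h
      exact ⟨a, h, ha⟩
    · rintro ⟨b, hb, hb'⟩
      rw [ha] at hb'
      obtain rfl := Option.some.inj hb'
      exact hb

end ToLogic
end NestedPebbles

namespace NestedPebbles
section Fragments
variable {Sig : Type} {rank : Sig → ℕ} {k : ℕ}

/-- The action at a control state of a program fragment. Pebbles are natural numbers. -/
inductive Act (Sig : Type) (k : ℕ) (S : Type) : Type
  | ins (χ : TInstr Sig k ℕ) (s : S)
  | tst (τ : TTest Sig k ℕ) (s1 s0 : S)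

def Act.map {S S' : Type} (f : S → S') : Act Sig k S → Act Sig k S'
  | .ins χ s => .ins χ (f s)
  | .tst τ s1 s0 => .tst τ (f s1) (f s0)

/-- Data configurations: heads and pebble stack. -/
abbrev HC (k : ℕ) (t : RTree Sig rank) : Type := (Fin k → Pos t) × List (ℕ × Pos t)

def ActStep (t : RTree Sig rank) {S : Type} (a : Act Sig k S) (c : HC k t) (s' : S) (c' : HC k t) :
    Prop :=
  match a with
  | .ins χ s => s' = s ∧ instrStep t χ c.1 c.2 c'.1 c'.2
  | .tst τ s1 s0 => c' = c ∧ ((testHolds t τ c.1 c.2 ∧ s' = s1) ∨ (¬ testHolds t τ c.1 c.2 ∧ s' = s0))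

theorem ActStep.map {t : RTree Sig rank} {S S' : Type} (f : S → S') {a : Act Sig k S}
    {c : HC k t} {s : S} {c' : HC k t} (h : ActStep t a c s c') : ActStep t (a.map f) c (f s) c' := by
  cases a with
  | ins χ s1 => exact ⟨congrArg f h.1, h.2⟩
  | tst τ s1 s0 =>
    obtain ⟨h1, ⟨h2, rfl⟩ | ⟨h2, rfl⟩⟩ := h
    · exact ⟨h1, Or.inl ⟨h2, rfl⟩⟩
    · exact ⟨h1, Or.inr ⟨h2, rfl⟩⟩

/-- Deterministic program fragments with exits in `E`. -/
structure Frag (Sig : Type) (k : ℕ) (E : Type) : Type 1 where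
  Q : Type
  fin : Finite Q
  start : Q
  δ : Q → Act Sig k (Q ⊕ E)

variable {E E' S : Type}

def FStep (t : RTree Sig rank) {Q : Type} (δ : Q → Act Sig k (Q ⊕ E))
    (c c' : (Q ⊕ E) × HC k t) : Prop :=
  ∃ q, c.1 = .inl q ∧ ActStep t (δ q) c.2 c'.1 c'.2

/-- `F`, started in `c`, runs to exit `e` with data configuration `c'`. -/
def Runs (F : Frag Sig k E) (t : RTree Sig rank) (c : HC k t) (e : E) (c' : HC k t) : Prop :=
  Relation.ReflTransGen (FStep t F.δ) (.inl F.start, c) (.inr e, c')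

def Frag.doI (χ : TInstr Sig k ℕ) : Frag Sig k Unit :=
  ⟨Unit, inferInstance, (), fun _ => .ins χ (.inr ())⟩

def Frag.tst (τ : TTest Sig k ℕ) : Frag Sig k Bool :=
  ⟨Unit, inferInstance, (), fun _ => .tst τ (.inr true) (.inr false)⟩

def Frag.ret [NeZero k] (e : E) : Frag Sig k E :=
  ⟨Unit, inferInstance, (), fun _ => .tst (.chno 0 0) (.inr e) (.inr e)⟩

def Frag.bind [Finite E] (F : Frag Sig k E) (G : E → Frag Sig k E') : Frag Sig k E' where
  Q := F.Q ⊕ (Σ e, (G e).Q)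
  fin := by
    have := F.fin
    have := fun e => (G e).fin
    infer_instance
  start := .inl F.start
  δ := Sum.elim
    (fun q => (F.δ q).map (Sum.elim (fun q => .inl (.inl q)) (fun e => .inl (.inr ⟨e, (G e).start⟩))))
    (fun z => ((G z.1).δ z.2).map (Sum.elim (fun q => .inl (.inr ⟨z.1, q⟩)) .inr))

def Frag.iter [Finite S] (B : S → Frag Sig k (S ⊕ E)) (s : S) : Frag Sig k E where
  Q := Σ s, (B s).Q
  fin := by
    have := fun e => (B e).fin
    infer_instance
  start := ⟨s, (B s).start⟩
  δ := fun z => ((B z.1).δ z.2).map (Sum.elim (fun q => .inl ⟨z.1, q⟩)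
    (Sum.elim (fun s' => .inl ⟨s', (B s').start⟩) .inr))

variable {t : RTree Sig rank}

theorem Runs.doI {χ : TInstr Sig k ℕ} {c c' : HC k t} (h : instrStep t χ c.1 c.2 c'.1 c'.2) :
    Runs (Frag.doI χ) t c () c' :=
  .single ⟨(), rfl, rfl, h⟩

theorem Runs.ret [NeZero k] (e : E) (c : HC k t) : Runs (Frag.ret e) t c e c := by
  refine .single ⟨(), rfl, rfl, ?_⟩
  by_cases h : testHolds t (.chno 0 0) c.1 c.2
  · exact Or.inl ⟨h, rfl⟩
  · exact Or.inr ⟨h, rfl⟩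

theorem Runs.bind [Finite E] {F : Frag Sig k E} {G : E → Frag Sig k E'} {c c' c'' : HC k t}
    {e : E} {e' : E'} (h1 : Runs F t c e c') (h2 : Runs (G e) t c' e' c'') :
    Runs (F.bind G) t c e' c'' := by
  have a1 := Relation.ReflTransGen.lift (p := FStep t (F.bind G).δ)
    (Prod.map (Sum.elim (fun q => .inl (.inl q)) (fun e => .inl (.inr ⟨e, (G e).start⟩))) id) (by
      rintro ⟨s, c⟩ ⟨s', c'⟩ ⟨q, hq, hs⟩
      simp only at hq hs
      subst hq
      exact ⟨_, rfl, hs.map _⟩) _ _ h1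
  have a2 := Relation.ReflTransGen.lift (p := FStep t (F.bind G).δ)
    (Prod.map (Sum.elim (fun q => .inl (.inr ⟨e, q⟩)) .inr) id) (by
      rintro ⟨s, c⟩ ⟨s', c'⟩ ⟨q, hq, hs⟩
      simp only at hq hs
      subst hq
      exact ⟨_, rfl, hs.map _⟩) _ _ h2
  exact Relation.ReflTransGen.trans a1 a2

theorem iter_lift [Finite S] {B : S → Frag Sig k (S ⊕ E)} {s0 s : S} {c c' : HC k t}
    {e : S ⊕ E} (h : Runs (B s) t c e c') :
    Relation.ReflTransGen (FStep t (Frag.iter B s0).δ) (.inl ⟨s, (B s).start⟩, c)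
      (Sum.elim (fun s' => .inl ⟨s', (B s').start⟩) .inr e, c') :=
  Relation.ReflTransGen.lift (p := FStep t (Frag.iter B s0).δ)
    (Prod.map (Sum.elim (fun q => .inl ⟨s, q⟩)
      (Sum.elim (fun s' => .inl ⟨s', (B s').start⟩) .inr)) id) (by
      rintro ⟨s, c⟩ ⟨s', c'⟩ ⟨q, hq, hs⟩
      simp only at hq hs
      subst hq
      exact ⟨_, rfl, hs.map _⟩) _ _ h

theorem Runs.iter_exit [Finite S] {B : S → Frag Sig k (S ⊕ E)} {s : S} {c c' : HC k t}
    {e : E} (h : Runs (B s) t c (.inr e) c') : Runs (Frag.iter B s) t c e c' :=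
  iter_lift h

theorem Runs.iter_step [Finite S] {B : S → Frag Sig k (S ⊕ E)} {s s' : S} {c c' c'' : HC k t}
    {e : E} (h : Runs (B s) t c (.inl s') c') (h' : Runs (Frag.iter B s') t c' e c'') :
    Runs (Frag.iter B s) t c e c'' :=
  Relation.ReflTransGen.trans (iter_lift h) h'

/-- `F` decides `P` at `c` without changing the configuration. -/
def Dec (F : Frag Sig k Bool) (t : RTree Sig rank) (c : HC k t) (P : Prop) : Prop :=
  ∀ b : Bool, (b = true ↔ P) → Runs F t c b c

/-- `F` decides `P` at `c` possibly moving the heads. -/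
def WDec (F : Frag Sig k Bool) (t : RTree Sig rank) (c : HC k t) (P : Prop) : Prop :=
  ∀ b : Bool, (b = true ↔ P) → ∃ hs', Runs F t c b (hs', c.2)

theorem Dec.wdec {F : Frag Sig k Bool} {c : HC k t} {P : Prop} (h : Dec F t c P) : WDec F t c P :=
  fun b hb => ⟨c.1, h b hb⟩

theorem exists_bool (P : Prop) : ∃ b : Bool, b = true ↔ P := by
  by_cases h : P
  · exact ⟨true, by simp [h]⟩
  · exact ⟨false, by simp [h]⟩

theorem WDec.congr {F : Frag Sig k Bool} {c : HC k t} {P P' : Prop} (h : WDec F t c P)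
    (hp : P' ↔ P) : WDec F t c P' := fun b hb => h b (hb.trans hp)

theorem Dec.congr {F : Frag Sig k Bool} {c : HC k t} {P P' : Prop} (h : Dec F t c P)
    (hp : P' ↔ P) : Dec F t c P' := fun b hb => h b (hb.trans hp)

theorem Dec.tst (τ : TTest Sig k ℕ) (c : HC k t) : Dec (Frag.tst τ) t c (testHolds t τ c.1 c.2) := by
  intro b hb
  refine .single ⟨(), rfl, rfl, ?_⟩
  cases b with
  | true => exact Or.inl ⟨hb.1 rfl, rfl⟩
  | false => exact Or.inr ⟨fun h => by simpa using hb.2 h, rfl⟩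

variable [NeZero k]

def Frag.notF (F : Frag Sig k Bool) : Frag Sig k Bool := F.bind fun b => .ret (!b)

def Frag.andF (F G : Frag Sig k Bool) : Frag Sig k Bool :=
  F.bind fun b => match b with
    | true => G
    | false => .ret false

theorem Dec.notF {F : Frag Sig k Bool} {c : HC k t} {P : Prop} (h : Dec F t c P) :
    Dec F.notF t c (¬ P) := by
  intro b hb
  have := (h (!b) (by cases b <;> simp_all)).bind (G := fun b => .ret (!b)) (Runs.ret _ c)
  rw [Bool.not_not] at this
  exact this

theorem WDec.notF {F : Frag Sig k Bool} {c : HC k t} {P : Prop} (h : WDec F t c P) :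
    WDec F.notF t c (¬ P) := by
  intro b hb
  obtain ⟨hs, h⟩ := h (!b) (by cases b <;> simp_all)
  have := h.bind (G := fun b => .ret (!b)) (Runs.ret _ _)
  rw [Bool.not_not] at this
  exact ⟨hs, this⟩

theorem Dec.andF {F G : Frag Sig k Bool} {c : HC k t} {P P' : Prop} (h : Dec F t c P)
    (h' : P → Dec G t c P') : Dec (F.andF G) t c (P ∧ P') := by
  intro b hb
  by_cases hp : P
  · exact (h true (by simp [hp])).bind (h' hp b (by simp_all))
  · have : b = false := by cases b <;> simp_all
    subst this
    exact (h false (by simp [hp])).bind (Runs.ret _ _)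

theorem WDec.andF {F G : Frag Sig k Bool} {c : HC k t} {P P' : Prop} (h : WDec F t c P)
    (h' : P → ∀ hs, WDec G t (hs, c.2) P') : WDec (F.andF G) t c (P ∧ P') := by
  intro b hb
  by_cases hp : P
  · obtain ⟨hs, h1⟩ := h true (by simp [hp])
    obtain ⟨hs', h2⟩ := h' hp hs b (by simp_all)
    exact ⟨hs', h1.bind h2⟩
  · have : b = false := by cases b <;> simp_all
    subst this
    obtain ⟨hs, h1⟩ := h false (by simp [hp])
    exact ⟨hs, h1.bind (Runs.ret _ _)⟩

/-- Case distinction by a list of tests. -/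
def Frag.caseF {ι : Type} (τ : ι → TTest Sig k ℕ) (G : ι → Frag Sig k E) (d : Frag Sig k E) :
    List ι → Frag Sig k E
  | [] => d
  | a :: l => (Frag.tst (τ a)).bind fun b => match b with
    | true => G a
    | false => Frag.caseF τ G d l

theorem Runs.caseF {ι : Type} {τ : ι → TTest Sig k ℕ} {G : ι → Frag Sig k E} {d : Frag Sig k E}
    {c c' : HC k t} {e : E} (a : ι) (h1 : testHolds t (τ a) c.1 c.2)
    (h2 : ∀ b, testHolds t (τ b) c.1 c.2 → b = a) (hG : Runs (G a) t c e c') :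
    ∀ l : List ι, a ∈ l → Runs (Frag.caseF τ G d l) t c e c'
  | [], h => by simp at h
  | b :: l, h => by
    by_cases hb : testHolds t (τ b) c.1 c.2
    · obtain rfl := h2 b hb
      exact (Dec.tst (τ b) c true (by simp [hb])).bind hG
    · refine (Dec.tst (τ b) c false (by simp [hb])).bind ?_
      refine Runs.caseF a h1 h2 hG l ?_
      rcases List.mem_cons.1 h with rfl | h
      · exact absurd h1 hb
      · exact h

/-- All heads are at the given pebbles. -/
def Frag.atL (ps : Fin k → ℕ) : List (Fin k) → Frag Sig k Bool
  | [] => .ret true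
  | i :: l => (Frag.tst (.peb i (ps i))).andF (Frag.atL ps l)

def Frag.atF (ps : Fin k → ℕ) : Frag Sig k Bool := Frag.atL ps (List.finRange k)

theorem Dec.ret_true (c : HC k t) : Dec (Frag.ret true) t c True := by
  intro b hb
  have : b = true := by simpa using hb
  subst this
  exact Runs.ret _ _

theorem Dec.ret_false (c : HC k t) : Dec (Frag.ret false) t c False := by
  intro b hb
  have : b = false := by simpa using hb
  subst this
  exact Runs.ret _ _

theorem Dec.atF (ps : Fin k → ℕ) (c : HC k t) :
    Dec (Frag.atF ps) t c (∀ i, (ps i, c.1 i) ∈ c.2) := by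
  have : ∀ l, Dec (Frag.atL ps l) t c (∀ i ∈ l, (ps i, c.1 i) ∈ c.2) := by
    intro l
    induction l with
    | nil => exact (Dec.ret_true c).congr (by simp)
    | cons i l ih => exact ((Dec.tst (.peb i (ps i)) c).andF fun _ => ih).congr (by simp [testHolds])
  exact (this _).congr (by simp)

end Fragments
end NestedPebbles

namespace NestedPebbles
section LexFacts

theorem lex_append_lt (c x y : List ℕ) : c ++ x < c ++ y ↔ x < y := by
  induction c with
  | nil => simp
  | cons a c ih => simp [List.cons_lt_cons_iff, ih]

theorem lex_snoc_zero {p q : List ℕ} (h : p < q) : p ++ [0] ≤ q := by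
  induction p generalizing q with
  | nil =>
    cases q with
    | nil => simp at h
    | cons y r => 
      rw [← not_lt]
      simp [List.cons_lt_cons_iff]
  | cons a p ih =>
    cases q with
    | nil => simp at h
    | cons y r =>
      rw [List.cons_lt_cons_iff] at h
      rw [← not_lt, List.cons_append, List.cons_lt_cons_iff]
      rcases h with h | ⟨rfl, h⟩
      · omega
      · have := ih h
        rw [← not_lt] at this
        simp [this]

theorem lex_between {c x q : List ℕ} {j : ℕ} (h1 : c ++ [j] ++ x < q) (h2 : q < c ++ [j + 1]) :
    c ++ [j] <+: q := by
  induction c generalizing q with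
  | nil =>
    cases q with
    | nil => simp at h1
    | cons y r =>
      simp [List.cons_lt_cons_iff] at h1 h2
      have : j = y := by omega
      subst this
      simp
  | cons a c ih =>
    cases q with
    | nil => simp at h1
    | cons y r =>
      simp only [List.cons_append, List.cons_lt_cons_iff] at h1 h2
      have : a = y := by omega
      subst this
      simp only [List.cons_append, List.cons_prefix_cons, true_and]
      apply ih
      · simpa using h1
      · simpa using h2

end LexFacts

section Next1
variable {Sig : Type} {rank : Sig → ℕ} {k : ℕ} [NeZero k]

def Frag.climb (rank : Sig → ℕ) (B : ℕ) (sigs : List Sig) (i : Fin k) : Frag Sig k Bool :=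
  Frag.iter (S := Unit) (fun _ => Frag.caseF (fun j => .chno i j) (fun j => match j with
     | 0 => .ret (.inr false)
     | j + 1 => (Frag.doI (.up i)).bind fun _ => Frag.caseF (fun a => .lab i a)
        (fun a => if j + 1 < rank a then (Frag.doI (.down i (j + 2))).bind fun _ => .ret (.inr true)
          else .ret (.inl ())) (.ret (.inr false)) sigs)
        (.ret (.inr false)) (List.range B)) ()

def Frag.next1 (rank : Sig → ℕ) (B : ℕ) (sigs : List Sig) (i : Fin k) : Frag Sig k Bool :=
  Frag.caseF (fun a => .lab i a)
    (fun a => if 0 < rank a then (Frag.doI (.down i 1)).bind fun _ => .ret true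
      else Frag.climb rank B sigs i) (.ret false) sigs

variable {t : RTree Sig rank}

theorem Runs.up {i : Fin k} {hs : Fin k → Pos t} {π : List (ℕ × Pos t)} (c' : Pos t) (j : ℕ)
    (h : (hs i).1 = c'.1 ++ [j]) : Runs (Frag.doI (.up i)) t (hs, π) () (Function.update hs i c', π) := by
  refine Runs.doI ⟨rfl, ⟨j, ?_⟩, ?_⟩
  · simpa using h
  · intro h hi
    exact Function.update_of_ne hi _ _

theorem Runs.down {i : Fin k} {hs : Fin k → Pos t} {π : List (ℕ × Pos t)} (c' : Pos t) (j : ℕ)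
    (h : c'.1 = (hs i).1 ++ [j]) :
    Runs (Frag.doI (.down i (j + 1))) t (hs, π) () (Function.update hs i c', π) := by
  refine Runs.doI ⟨rfl, by omega, ?_, ?_⟩
  · simpa using h
  · intro h hi
    exact Function.update_of_ne hi _ _

theorem Runs.caseLab {E : Type} {sigs : List Sig} (hsig : ∀ a, a ∈ sigs) {G : Sig → Frag Sig k E}
    {d : Frag Sig k E} {i : Fin k} {c c' : HC k t} {e : E} {a : Sig} (ha : labelAt t (c.1 i).1 = some a)
    (h : Runs (G a) t c e c') : Runs (Frag.caseF (fun a => .lab i a) G d sigs) t c e c' := by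
  refine Runs.caseF (τ := fun a => .lab i a) a ha ?_ h _ (hsig a)
  intro b hb
  have : labelAt t (c.1 i).1 = some b := hb
  simpa [ha] using this.symm

theorem Runs.caseCh {E : Type} {B : ℕ} (hB : ∀ a, rank a < B) {G : ℕ → Frag Sig k E}
    {d : Frag Sig k E} {i : Fin k} {c c' : HC k t} {e : E}
    (h : Runs (G (childNo (c.1 i).1)) t c e c') :
    Runs (Frag.caseF (fun j => .chno i j) G d (List.range B)) t c e c' := by
  refine Runs.caseF (τ := fun j => .chno i j) _ rfl ?_ h _ ?_
  · intro b hb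
    exact hb.symm
  · rw [List.mem_range]
    obtain ⟨p, hp⟩ : ∃ p, p = (c.1 i).1 := ⟨_, rfl⟩
    rw [← hp]
    rcases List.eq_nil_or_concat p with rfl | ⟨q, j, rfl⟩
    · obtain ⟨a, _⟩ := exists_label t (c.1 i)
      have := hB a
      rw [childNo_nil]; omega
    · have h := (c.1 i).2
      rw [← hp, List.concat_eq_append] at h
      rw [List.concat_eq_append, childNo_snoc]
      exact snoc_lt hB h

/-- Immediate successor in the preorder. -/
def IsSucc (t : RTree Sig rank) (p b : Pos t) : Prop :=
  p.1 < b.1 ∧ ∀ q : Pos t, p.1 < q.1 → b.1 ≤ q.1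

theorem climb_spec {B : ℕ} (hB : ∀ a, rank a < B) {sigs : List Sig} (hsig : ∀ a, a ∈ sigs)
    (i : Fin k) (p : Pos t) (π : List (ℕ × Pos t)) (c : List ℕ) :
    ∀ (hs : Fin k → Pos t), (hs i).1 = c → c <+: p.1 → (∀ q : Pos t, p.1 < q.1 → ¬ c <+: q.1) →
    (∃ b, IsSucc t p b ∧ Runs (Frag.climb rank B sigs i) t (hs, π) true (Function.update hs i b, π)) ∨
    ((∀ q : Pos t, ¬ p.1 < q.1) ∧
      Runs (Frag.climb rank B sigs i) t (hs, π) false (Function.update hs i (rootPos t), π)) := by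
  induction c using List.reverseRecOn with
  | nil =>
    intro hs hc _ hI
    right
    refine ⟨fun q hq => hI q hq (by simp), ?_⟩
    have : hs i = rootPos t := Subtype.ext hc
    rw [← this, Function.update_eq_self]
    apply Runs.iter_exit
    apply Runs.caseCh hB
    simp only [hc, childNo_nil]
    exact Runs.ret _ _
  | append_singleton c j ih =>
    intro hs hc hp hI
    have hpos := (hs i).2
    rw [hc] at hpos
    obtain ⟨C, hC⟩ : ∃ C : Pos t, C.1 = c := ⟨⟨c, isPos_initial hpos⟩, rfl⟩
    obtain ⟨a, ha⟩ := exists_label t C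
    have hup : Runs (Frag.doI (Sig := Sig) (.up i)) t (hs, π) () (Function.update hs i C, π) :=
      Runs.up C j (by rw [hc, hC])
    have hUi : (Function.update hs i C) i = C := Function.update_self _ _ _
    have hch : childNo (hs i).1 = j + 1 := by rw [hc, childNo_snoc]
    by_cases hj : j + 1 < rank a
    · left
      rw [hC] at ha
      obtain ⟨b, hb⟩ : ∃ b : Pos t, b.1 = c ++ [j + 1] := ⟨⟨_, (isPos_snoc ha).2 hj⟩, rfl⟩
      refine ⟨b, ⟨?_, ?_⟩, ?_⟩
      · obtain ⟨x, hx⟩ := hp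
        rw [← hx, hb, List.append_assoc, lex_append_lt]
        simp [List.cons_lt_cons_iff]
      · intro q hq
        rw [← not_lt]
        intro hqb
        obtain ⟨x, hx⟩ := hp
        rw [hb] at hqb
        refine hI q hq (lex_between (x := x) ?_ hqb)
        rw [hx]; exact hq
      · apply Runs.iter_exit
        apply Runs.caseCh hB
        simp only [hch]
        refine hup.bind ?_
        refine Runs.caseLab hsig (a := a) (by simp only [hUi, hC]; exact ha) ?_
        rw [if_pos hj]
        have := Runs.down (i := i) (hs := Function.update hs i C) (π := π) b (j + 1)
          (by rw [hUi, hb, hC])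
        rw [Function.update_idem] at this
        exact this.bind (Runs.ret _ _)
    · have hstep : Runs (Frag.caseF (fun j => .chno i j) (fun j => match j with
          | 0 => .ret (.inr false)
          | j + 1 => (Frag.doI (.up i)).bind fun _ => Frag.caseF (fun a => .lab i a)
            (fun a => if j + 1 < rank a then (Frag.doI (.down i (j + 2))).bind fun _ => .ret (.inr true)
            else .ret (.inl ())) (.ret (.inr false)) sigs)
            (.ret (.inr false)) (List.range B)) t (hs, π) (.inl () : Unit ⊕ Bool) (Function.update hs i C, π) := by
        apply Runs.caseCh hB
        simp only [hch]
        refine hup.bind ?_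
        refine Runs.caseLab hsig (a := a) (by simp only [hUi]; exact ha) ?_
        rw [if_neg hj]
        exact Runs.ret _ _
      have := ih (Function.update hs i C) (by rw [hUi, hC]) ((List.prefix_append _ _).trans hp) (by
        intro q hq hcq
        apply hI q hq
        obtain ⟨x, hx⟩ := hp
        obtain ⟨r, hr⟩ := hcq
        rw [← hx, ← hr, List.append_assoc, lex_append_lt] at hq
        cases r with
        | nil => simp at hq
        | cons y r =>
          simp only [List.cons_append, List.nil_append, List.cons_lt_cons_iff] at hq
          have hq2 := q.2
          rw [← hr, show c ++ y :: r = (c ++ [y]) ++ r by simp] at hq2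
          rw [hC] at ha
          have := (isPos_snoc ha).1 (isPos_initial hq2)
          have : y = j := by omega
          subst this
          rw [← hr]
          simp)
      simp only [Function.update_idem] at this
      rcases this with ⟨b, hb, hr⟩ | ⟨h, hr⟩
      · exact Or.inl ⟨b, hb, Runs.iter_step hstep hr⟩
      · exact Or.inr ⟨h, Runs.iter_step hstep hr⟩

theorem next1_spec {B : ℕ} (hB : ∀ a, rank a < B) {sigs : List Sig} (hsig : ∀ a, a ∈ sigs)
    (i : Fin k) (π : List (ℕ × Pos t)) (hs : Fin k → Pos t) :
    (∃ b, IsSucc t (hs i) b ∧ Runs (Frag.next1 rank B sigs i) t (hs, π) true (Function.update hs i b, π)) ∨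
    ((∀ q : Pos t, ¬ (hs i).1 < q.1) ∧
      Runs (Frag.next1 rank B sigs i) t (hs, π) false (Function.update hs i (rootPos t), π)) := by
  obtain ⟨a, ha⟩ := exists_label t (hs i)
  by_cases h0 : 0 < rank a
  · left
    obtain ⟨b, hb⟩ : ∃ b : Pos t, b.1 = (hs i).1 ++ [0] := ⟨⟨_, (isPos_snoc ha).2 h0⟩, rfl⟩
    refine ⟨b, ⟨?_, ?_⟩, ?_⟩
    · rw [hb]
      nth_rw 1 [← List.append_nil (hs i).1]
      rw [lex_append_lt]
      simp
    · intro q hq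
      rw [hb]
      exact lex_snoc_zero hq
    · refine Runs.caseLab hsig ha ?_
      rw [if_pos h0]
      exact (Runs.down b 0 hb).bind (Runs.ret _ _)
  · have hc : ∀ e c', Runs (Frag.climb rank B sigs i) t (hs, π) e c' →
        Runs (Frag.next1 rank B sigs i) t (hs, π) e c' := by
      intro e c' h
      refine Runs.caseLab hsig ha ?_
      rw [if_neg h0]
      exact h
    rcases climb_spec hB hsig i (hs i) π _ hs rfl (List.prefix_refl _) (by
      rintro q hq ⟨r, hr⟩
      cases r with
      | nil =>
        rw [← hr] at hq
        simp at hq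
      | cons y r =>
        have hq2 := q.2
        rw [← hr, show (hs i).1 ++ y :: r = ((hs i).1 ++ [y]) ++ r by simp] at hq2
        have := (isPos_snoc ha).1 (isPos_initial hq2)
        omega) with ⟨b, hb, hr⟩ | ⟨h, hr⟩
    · exact Or.inl ⟨b, hb, hc _ _ hr⟩
    · exact Or.inr ⟨h, hc _ _ hr⟩

end Next1

section Rank
variable {Sig : Type} {rank : Sig → ℕ} {k : ℕ}

theorem finite_isPos (t : RTree Sig rank) : {p | IsPos t p}.Finite := by
  induction t with
  | node a c ih =>
    have : {p | IsPos (RTree.node a c) p} ⊆ {[]} ∪ ⋃ j : Fin (rank a), (fun p => j.1 :: p) '' {p | IsPos (c j) p} := by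
      intro p hp
      cases p with
      | nil => simp
      | cons j p =>
        right
        have hp : ((RTree.node a c).subtree (j :: p)).isSome = true := hp
        by_cases hj : j < rank a
        · simp only [RTree.subtree, RTree.child, hj, dite_true, Option.bind_some] at hp
          exact Set.mem_iUnion.2 ⟨⟨j, hj⟩, p, hp, rfl⟩
        · simp [RTree.subtree, RTree.child, hj] at hp
    refine Set.Finite.subset ?_ this
    exact (Set.finite_singleton _).union (Set.finite_iUnion fun j => (ih j).image _)

instance (t : RTree Sig rank) : Finite (Pos t) := (finite_isPos t).to_subtype

noncomputable def rk1 (t : RTree Sig rank) (p : Pos t) : ℕ := Set.ncard {q : Pos t | q.1 < p.1}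

theorem rk1_lt {t : RTree Sig rank} {p q : Pos t} (h : p.1 < q.1) : rk1 t p < rk1 t q := by
  apply Set.ncard_lt_ncard
  · refine ⟨fun x hx => lt_trans hx h, fun hs => ?_⟩
    exact lt_irrefl p.1 (hs (show p ∈ {x : Pos t | x.1 < q.1} from h))
  · exact Set.toFinite _

theorem rk1_inj (t : RTree Sig rank) : Function.Injective (rk1 t) := by
  intro p q h
  rcases lt_trichotomy p.1 q.1 with h1 | h1 | h1
  · exact absurd h (rk1_lt h1).ne
  · exact Subtype.ext h1
  · exact absurd h (rk1_lt h1).ne'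

theorem rk1_root (t : RTree Sig rank) : rk1 t (rootPos t) = 0 := by
  have : {q : Pos t | q.1 < (rootPos t).1} = ∅ := by
    ext q
    simp [rootPos]
  rw [rk1, this, Set.ncard_empty]

theorem rk1_bound (t : RTree Sig rank) (p : Pos t) : rk1 t p < Nat.card (Pos t) := by
  rw [← Set.ncard_univ]
  apply Set.ncard_lt_ncard
  · refine ⟨fun x hx => trivial, fun hs => ?_⟩
    exact lt_irrefl p.1 (hs (Set.mem_univ p))
  · exact Set.toFinite _

theorem rk1_succ {t : RTree Sig rank} {p b : Pos t} (h : IsSucc t p b) : rk1 t b = rk1 t p + 1 := by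
  have : {q : Pos t | q.1 < b.1} = insert p {q : Pos t | q.1 < p.1} := by
    ext q
    simp only [Set.mem_insert_iff, Set.mem_ofPred_eq]
    constructor
    · intro hq
      rcases lt_trichotomy q.1 p.1 with h1 | h1 | h1
      · exact Or.inr h1
      · exact Or.inl (Subtype.ext h1)
      · exact absurd hq (not_lt.2 (h.2 q h1))
    · rintro (rfl | hq)
      · exact h.1
      · exact lt_trans hq h.1
  rw [rk1, this, Set.ncard_insert_of_notMem (by simp) (Set.toFinite _), rk1]

theorem rk1_max {t : RTree Sig rank} {p : Pos t} (h : ∀ q : Pos t, ¬ p.1 < q.1) :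
    rk1 t p + 1 = Nat.card (Pos t) := by
  have : (Set.univ : Set (Pos t)) = insert p {q : Pos t | q.1 < p.1} := by
    ext q
    simp only [Set.mem_insert_iff, Set.mem_ofPred_eq, Set.mem_univ, true_iff]
    rcases lt_trichotomy q.1 p.1 with h1 | h1 | h1
    · exact Or.inr h1
    · exact Or.inl (Subtype.ext h1)
    · exact absurd h1 (h q)
  rw [← Set.ncard_univ, this, Set.ncard_insert_of_notMem (by simp) (Set.toFinite _), rk1]

end Rank

section Odometer
variable {Sig : Type} {rank : Sig → ℕ} {k : ℕ} [NeZero k]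

def Frag.nextL (F : Fin k → Frag Sig k Bool) : List (Fin k) → Frag Sig k Bool
  | [] => .ret false
  | i :: l => (F i).bind fun b => match b with
    | true => .ret true
    | false => Frag.nextL F l

noncomputable def rkL (t : RTree Sig rank) : List (Fin k) → (Fin k → Pos t) → ℕ
  | [], _ => 0
  | i :: l, a => rk1 t (a i) + Nat.card (Pos t) * rkL t l a

theorem rkL_congr (t : RTree Sig rank) (l : List (Fin k)) (a b : Fin k → Pos t)
    (h : ∀ i ∈ l, a i = b i) : rkL t l a = rkL t l b := by
  induction l with
  | nil => rfl
  | cons i l ih =>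
    rw [rkL, rkL, h i (by simp), ih fun j hj => h j (by simp [hj])]

theorem rkL_inj (t : RTree Sig rank) (l : List (Fin k)) (a b : Fin k → Pos t)
    (h : rkL t l a = rkL t l b) : ∀ i ∈ l, a i = b i := by
  induction l with
  | nil => simp
  | cons i l ih =>
    have h1 := congrArg (· % Nat.card (Pos t)) h
    simp only [rkL, Nat.add_mul_mod_self_left, Nat.mod_eq_of_lt (rk1_bound t _)] at h1
    rw [rkL, rkL, h1] at h
    have hN : 0 < Nat.card (Pos t) := (Nat.zero_le _).trans_lt (rk1_bound t (a i))
    have h2 := Nat.eq_of_mul_eq_mul_left hN (Nat.add_left_cancel h)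
    intro j hj
    rcases List.mem_cons.1 hj with rfl | hj
    · exact rk1_inj t h1
    · exact ih h2 j hj

theorem nextL_spec {B : ℕ} (hB : ∀ a, rank a < B) {sigs : List Sig} (hsig : ∀ a, a ∈ sigs)
    (t : RTree Sig rank) (π : List (ℕ × Pos t)) (l : List (Fin k)) (hl : l.Nodup) (a : Fin k → Pos t) :
    (∃ b, rkL t l b = rkL t l a + 1 ∧ (∀ i ∉ l, b i = a i) ∧
      Runs (Frag.nextL (Frag.next1 rank B sigs) l) t (a, π) true (b, π)) ∨
    ((∀ b, rkL t l b ≤ rkL t l a) ∧ ∃ b, (∀ i ∈ l, b i = rootPos t) ∧ (∀ i ∉ l, b i = a i) ∧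
      Runs (Frag.nextL (Frag.next1 rank B sigs) l) t (a, π) false (b, π)) := by
  induction l generalizing a with
  | nil =>
    right
    exact ⟨fun b => le_refl _, a, by simp, by simp, Runs.ret _ _⟩
  | cons i l ih =>
    have hil : i ∉ l := (List.nodup_cons.1 hl).1
    have hne : ∀ j ∈ l, j ≠ i := fun j hj h => hil (h ▸ hj)
    have hcg : ∀ x, rkL t l (Function.update a i x) = rkL t l a := fun x =>
      rkL_congr _ _ _ _ fun j hj => Function.update_of_ne (hne j hj) _ _
    rcases next1_spec hB hsig i π a with ⟨b, hb, hr⟩ | ⟨h, hr⟩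
    · left
      refine ⟨_, ?_, ?_, hr.bind (Runs.ret _ _)⟩
      · rw [rkL, rkL, Function.update_self, rk1_succ hb, hcg]
        omega
      · intro j hj
        exact Function.update_of_ne (fun h => hj (by simp [h])) _ _
    · have hmax := rk1_max h
      rcases ih (List.nodup_cons.1 hl).2 (Function.update a i (rootPos t)) with
        ⟨b, h1, h2, h3⟩ | ⟨h1, b, h2, h3, h4⟩
      · left
        refine ⟨b, ?_, ?_, hr.bind h3⟩
        · rw [rkL, rkL, h1, h2 i hil, Function.update_self, rk1_root, hcg, Nat.mul_add]
          omega
        · intro j hj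
          simp only [List.mem_cons, not_or] at hj
          rw [h2 j hj.2, Function.update_of_ne hj.1]
      · right
        refine ⟨?_, b, ?_, ?_, hr.bind h4⟩
        · intro x
          have e1 := rk1_bound t (x i)
          have e2 := h1 x
          rw [hcg] at e2
          rw [rkL, rkL]
          have := Nat.mul_le_mul_left (Nat.card (Pos t)) e2
          omega
        · intro j hj
          rcases List.mem_cons.1 hj with rfl | hj
          · rw [h3 _ hil, Function.update_self]
          · exact h2 j hj
        · intro j hj
          simp only [List.mem_cons, not_or] at hj
          rw [h3 j hj.2, Function.update_of_ne hj.1]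

/-- Enumeration of all tuples of nodes. -/
theorem exists_nextF [Finite Sig] : ∃ F : Frag Sig k Bool, ∀ t : RTree Sig rank,
    ∃ rk : (Fin k → Pos t) → ℕ, Function.Injective rk ∧ rk (fun _ => rootPos t) = 0 ∧
      ∀ a π, (∃ b, rk b = rk a + 1 ∧ Runs F t (a, π) true (b, π)) ∨
        ((∀ b, rk b ≤ rk a) ∧ Runs F t (a, π) false (fun _ => rootPos t, π)) := by
  obtain ⟨B, hB⟩ := exists_bound Sig rank
  have := Fintype.ofFinite Sig
  have hsig : ∀ a : Sig, a ∈ (Finset.univ : Finset Sig).toList := by simp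
  refine ⟨Frag.nextL (Frag.next1 rank B (Finset.univ : Finset Sig).toList) (List.finRange k), fun t =>
    ⟨rkL t (List.finRange k), ?_, ?_, ?_⟩⟩
  · intro a b h
    funext i
    exact rkL_inj t _ a b h i (List.mem_finRange i)
  · have : ∀ l : List (Fin k), rkL t l (fun _ => rootPos t) = 0 := by
      intro l
      induction l with
      | nil => rfl
      | cons i l ih => simp [rkL, ih, rk1_root]
    exact this _
  · intro a π
    rcases nextL_spec hB hsig t π _ (List.nodup_finRange k) a with ⟨b, h1, h2, h3⟩ | ⟨h1, b, h2, h3, h4⟩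
    · exact Or.inl ⟨b, h1, h3⟩
    · have : b = fun _ => rootPos t := funext fun i => h2 i (List.mem_finRange i)
      subst this
      exact Or.inr ⟨h1, h4⟩

end Odometer
end NestedPebbles

namespace NestedPebbles
section Combinators
variable {Sig : Type} {rank : Sig → ℕ} {k : ℕ}

/-- A program enumerating all tuples of nodes. -/
structure Nx (Sig : Type) (rank : Sig → ℕ) (k : ℕ) where
  F : Frag Sig k Bool
  rk : ∀ t : RTree Sig rank, (Fin k → Pos t) → ℕ
  inj : ∀ t, Function.Injective (rk t)
  root : ∀ t, rk t (fun _ => rootPos t) = 0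
  spec : ∀ t a π, (∃ b, rk t b = rk t a + 1 ∧ Runs F t (a, π) true (b, π)) ∨
        ((∀ b, rk t b ≤ rk t a) ∧ Runs F t (a, π) false (fun _ => rootPos t, π))

theorem exists_Nx [Finite Sig] [NeZero k] : Nonempty (Nx Sig rank k) := by
  obtain ⟨F, hF⟩ := exists_nextF (Sig := Sig) (rank := rank) (k := k)
  choose rk h1 h2 h3 using hF
  exact ⟨⟨F, rk, h1, h2, h3⟩⟩

variable (X : Nx Sig rank k) {t : RTree Sig rank} {π : List (ℕ × Pos t)}

theorem Nx.bounded (X : Nx Sig rank k) (t : RTree Sig rank) : ∃ M, ∀ a, X.rk t a ≤ M := by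
  obtain ⟨M, hM⟩ := (Set.finite_range (X.rk t)).bddAbove
  exact ⟨M, fun a => hM ⟨a, rfl⟩⟩

variable [NeZero k]

def Nx.toRoot : Frag Sig k Unit :=
  Frag.iter (S := Unit) (fun _ => X.F.bind fun b => match b with
    | true => .ret (.inl ())
    | false => .ret (.inr ())) ()

theorem Nx.runs_toRoot (a : Fin k → Pos t) : Runs X.toRoot t (a, π) () (fun _ => rootPos t, π) := by
  obtain ⟨M, hM⟩ := X.bounded t
  have : ∀ n a, M - X.rk t a = n → Runs X.toRoot t (a, π) () (fun _ => rootPos t, π) := by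
    intro n
    induction n with
    | zero =>
      intro a ha
      rcases X.spec t a π with ⟨b, h1, h2⟩ | ⟨h1, h2⟩
      · have := hM b
        omega
      · exact Runs.iter_exit (h2.bind (Runs.ret _ _))
    | succ n ih =>
      intro a ha
      rcases X.spec t a π with ⟨b, h1, h2⟩ | ⟨h1, h2⟩
      · exact Runs.iter_step (h2.bind (Runs.ret _ _)) (ih b (by omega))
      · exact Runs.iter_exit (h2.bind (Runs.ret _ _))
  exact this _ a rfl

def Nx.search (G : Frag Sig k Bool) : Frag Sig k Bool :=
  Frag.iter (S := Unit) (fun _ => G.bind fun b => match b with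
    | true => .ret (.inr true)
    | false => X.F.bind fun b => match b with
      | true => .ret (.inl ())
      | false => .ret (.inr false)) ()

theorem Nx.search_spec {G : Frag Sig k Bool} {P : (Fin k → Pos t) → Prop}
    (hG : ∀ b, Dec G t (b, π) (P b)) (a : Fin k → Pos t) :
    (∃ b, X.rk t a ≤ X.rk t b ∧ P b ∧ (∀ c, X.rk t a ≤ X.rk t c → P c → X.rk t b ≤ X.rk t c) ∧
      Runs (X.search G) t (a, π) true (b, π)) ∨
    ((∀ c, X.rk t a ≤ X.rk t c → ¬ P c) ∧ Runs (X.search G) t (a, π) false (fun _ => rootPos t, π)) := by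
  obtain ⟨M, hM⟩ := X.bounded t
  obtain ⟨n, hn⟩ : ∃ n, M - X.rk t a = n := ⟨_, rfl⟩
  induction n using Nat.strong_induction_on generalizing a with
  | _ n ih =>
    by_cases hP : P a
    · left
      refine ⟨a, le_refl _, hP, fun c h _ => h, ?_⟩
      exact Runs.iter_exit ((hG a true (by simp [hP])).bind (Runs.ret _ _))
    · have hf := hG a false (by simp [hP])
      rcases X.spec t a π with ⟨b, h1, h2⟩ | ⟨h1, h2⟩
      · have hlt : ∀ c, P c → X.rk t a ≤ X.rk t c → X.rk t b ≤ X.rk t c := by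
          intro c hc hac
          rcases hac.lt_or_eq with h | h
          · omega
          · exact absurd (X.inj t h ▸ hc) hP
        have hb := hM b
        rcases ih _ (by omega) b rfl with ⟨b', g1, g2, g3, g4⟩ | ⟨g1, g2⟩
        · left
          refine ⟨b', by omega, g2, fun c hc hPc => g3 c (hlt c hPc hc) hPc, ?_⟩
          exact Runs.iter_step (hf.bind (h2.bind (Runs.ret _ _))) g4
        · right
          refine ⟨fun c hc hPc => g1 c (hlt c hPc hc) hPc, ?_⟩
          exact Runs.iter_step (hf.bind (h2.bind (Runs.ret _ _))) g2
      · right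
        refine ⟨fun c hc hPc => ?_, Runs.iter_exit (hf.bind (h2.bind (Runs.ret _ _)))⟩
        have := X.inj t (le_antisymm (h1 c) hc)
        exact hP (this ▸ hPc)

def Nx.find (G : Frag Sig k Bool) : Frag Sig k Bool := X.toRoot.bind fun _ => X.search G

theorem Nx.find_spec {G : Frag Sig k Bool} {P : (Fin k → Pos t) → Prop}
    (hG : ∀ b, Dec G t (b, π) (P b)) (a : Fin k → Pos t) :
    (∃ b, P b ∧ (∀ c, P c → X.rk t b ≤ X.rk t c) ∧ Runs (X.find G) t (a, π) true (b, π)) ∨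
    ((∀ c, ¬ P c) ∧ Runs (X.find G) t (a, π) false (fun _ => rootPos t, π)) := by
  rcases X.search_spec hG (fun _ => rootPos t) with ⟨b, h1, h2, h3, h4⟩ | ⟨h1, h2⟩
  · exact Or.inl ⟨b, h2, fun c hc => h3 c (by rw [X.root]; omega) hc, (X.runs_toRoot a).bind h4⟩
  · exact Or.inr ⟨fun c => h1 c (by rw [X.root]; omega), (X.runs_toRoot a).bind h2⟩

/-- Find the unique tuple. -/
theorem Nx.find_unique {G : Frag Sig k Bool} {P : (Fin k → Pos t) → Prop}
    (hG : ∀ b, Dec G t (b, π) (P b)) (a b : Fin k → Pos t) (hb : ∀ c, P c ↔ c = b) :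
    Runs (X.find G) t (a, π) true (b, π) := by
  rcases X.find_spec hG a with ⟨b', h1, h2, h3⟩ | ⟨h1, _⟩
  · obtain rfl := (hb b').1 h1
    exact h3
  · exact absurd ((hb b).2 rfl) (h1 b)

/-- The pebbles `e x` lie on `ν x`. -/
def Rep {ι : Type} (e : ι → ℕ) (ν : ι → Pos t) (π : List (ℕ × Pos t)) : Prop :=
  ∀ x w, (e x, w) ∈ π ↔ w = ν x

def Fresh (π : List (ℕ × Pos t)) (d : ℕ) : Prop := ∀ x w, (x, w) ∈ π → x < d

def pushL (d : ℕ) (hs : Fin k → Pos t) : List (Fin k) → List (ℕ × Pos t) → List (ℕ × Pos t)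
  | [], π => π
  | i :: l, π => pushL d hs l ((d + i.1, hs i) :: π)

def push (d : ℕ) (hs : Fin k → Pos t) (π : List (ℕ × Pos t)) : List (ℕ × Pos t) :=
  pushL d hs (List.finRange k) π

theorem mem_pushL {d : ℕ} {hs : Fin k → Pos t} {l : List (Fin k)} {x : ℕ} {w : Pos t} :
    (x, w) ∈ pushL d hs l π ↔ (∃ i ∈ l, x = d + i.1 ∧ w = hs i) ∨ (x, w) ∈ π := by
  induction l generalizing π with
  | nil => simp [pushL]
  | cons i l ih =>
    rw [pushL, ih]
    simp only [List.mem_cons, Prod.mk.injEq]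
    constructor
    · rintro (⟨j, h1, h2⟩ | h | h)
      · exact Or.inl ⟨j, Or.inr h1, h2⟩
      · exact Or.inl ⟨i, Or.inl rfl, h⟩
      · exact Or.inr h
    · rintro (⟨j, rfl | h1, h2⟩ | h)
      · exact Or.inr (Or.inl h2)
      · exact Or.inl ⟨j, h1, h2⟩
      · exact Or.inr (Or.inr h)

theorem mem_push {d : ℕ} {hs : Fin k → Pos t} {x : ℕ} {w : Pos t} :
    (x, w) ∈ push d hs π ↔ (∃ i : Fin k, x = d + i.1 ∧ w = hs i) ∨ (x, w) ∈ π := by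
  rw [push, mem_pushL]
  simp

theorem Fresh.push {d : ℕ} (h : Fresh π d) (hs : Fin k → Pos t) : Fresh (push d hs π) (d + k) := by
  intro x w hx
  rcases mem_push.1 hx with ⟨i, rfl, _⟩ | hx
  · have := i.2
    omega
  · have := h _ _ hx
    omega

theorem Rep.lt {ι : Type} {e : ι → ℕ} {ν : ι → Pos t} {d : ℕ} (h : Rep e ν π) (hf : Fresh π d) (x : ι) :
    e x < d := hf _ _ ((h x _).2 rfl)

theorem Rep.push {ι : Type} {e : ι → ℕ} {ν : ι → Pos t} {d : ℕ} (h : Rep e ν π) (hf : Fresh π d)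
    (hs : Fin k → Pos t) : Rep e ν (push d hs π) := by
  intro x w
  rw [mem_push, ← h x w]
  constructor
  · rintro (⟨i, h1, _⟩ | h1)
    · have := h.lt hf x
      omega
    · exact h1
  · exact Or.inr

/-- The block of pebbles starting at `d`. -/
def blk (k d : ℕ) : Fin k → ℕ := fun i => d + i.1

theorem Rep.blk {d : ℕ} (hf : Fresh π d) (hs : Fin k → Pos t) : Rep (blk k d) hs (NestedPebbles.push d hs π) := by
  intro i w
  rw [mem_push]
  constructor
  · rintro (⟨j, h1, h2⟩ | h1)
    · have : i = j := by
        ext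
        simp only [NestedPebbles.blk] at h1
        omega
      rw [this, h2]
    · have := hf _ _ h1
      simp only [NestedPebbles.blk] at this
      omega
  · intro h
    exact Or.inl ⟨i, rfl, h⟩

theorem Rep.updVec {e : ℕ → ℕ} {ν : ℕ → Pos t} {ps : Fin k → ℕ} {a : Fin k → Pos t} (h : Rep e ν π)
    (h' : Rep ps a π) (xs : Fin k → ℕ) :
    Rep (NestedPebbles.updVec e xs ps) (NestedPebbles.updVec ν xs a) π := by
  intro n w
  unfold NestedPebbles.updVec
  by_cases hn : ∃ i, xs i = n
  · simp only [hn, dite_true]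
    exact h' _ _
  · simp only [hn, dite_false]
    exact h _ _

theorem Rep.update {e : ℕ → ℕ} {ν : ℕ → Pos t} {ps : Fin k → ℕ} {a : Fin k → Pos t} (h : Rep e ν π)
    (h' : Rep ps a π) (x : ℕ) (i : Fin k) :
    Rep (Function.update e x (ps i)) (Function.update ν x (a i)) π := by
  intro n w
  by_cases hn : n = x
  · subst hn
    rw [Function.update_self, Function.update_self]
    exact h' _ _
  · rw [Function.update_of_ne hn, Function.update_of_ne hn]
    exact h _ _

theorem Rep.comp {ι κ : Type} {e : ι → ℕ} {ν : ι → Pos t} (h : Rep e ν π) (f : κ → ι) :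
    Rep (fun x => e (f x)) (fun x => ν (f x)) π := fun x w => h (f x) w

theorem Rep.atF {ps : Fin k → ℕ} {a : Fin k → Pos t} (h : Rep ps a π) (hs : Fin k → Pos t) :
    Dec (Frag.atF ps) t (hs, π) (hs = a) := by
  refine (Dec.atF ps (hs, π)).congr ?_
  constructor
  · rintro rfl i
    exact (h _ _).2 rfl
  · intro h'
    funext i
    exact (h _ _).1 (h' i)

/-- Go to the tuple of given pebbles. -/
def Nx.goto (ps : Fin k → ℕ) : Frag Sig k Unit := (X.find (Frag.atF ps)).bind fun _ => .ret ()

theorem Nx.runs_goto {ps : Fin k → ℕ} {a : Fin k → Pos t} (h : Rep ps a π) (hs : Fin k → Pos t) :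
    Runs (X.goto ps) t (hs, π) () (a, π) :=
  (X.find_unique (h.atF) hs a (fun _ => Iff.rfl)).bind (Runs.ret _ _)

def Frag.dropL (d : ℕ) : List (Fin k) → Frag Sig k Unit
  | [] => .ret ()
  | i :: l => (Frag.doI (.dropPeb i (d + i.1))).bind fun _ => Frag.dropL d l

def Frag.retrL (d : ℕ) : List (Fin k) → Frag Sig k Unit
  | [] => .ret ()
  | i :: l => (Frag.retrL d l).bind fun _ => Frag.doI (.retrieve (d + i.1))

def Frag.drop (d : ℕ) : Frag Sig k Unit := Frag.dropL d (List.finRange k)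
def Frag.retr (d : ℕ) : Frag Sig k Unit := Frag.retrL d (List.finRange k)

theorem Runs.drop {d : ℕ} (hf : Fresh π d) (hs : Fin k → Pos t) :
    Runs (Frag.drop d : Frag Sig k Unit) t (hs, π) () (hs, push d hs π) := by
  have : ∀ l : List (Fin k), l.Nodup → ∀ π : List (ℕ × Pos t), (∀ i ∈ l, ∀ w, (d + i.1, w) ∉ π) →
      Runs (Frag.dropL d l : Frag Sig k Unit) t (hs, π) () (hs, pushL d hs l π) := by
    intro l
    induction l with
    | nil => exact fun _ _ _ => Runs.ret _ _
    | cons i l ih =>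
      intro hl π hπ
      refine Runs.bind (Runs.doI (c' := (hs, (d + i.1, hs i) :: π)) ⟨rfl, rfl, hπ i (by simp)⟩) ?_
      refine ih (List.nodup_cons.1 hl).2 _ ?_
      intro j hj w hw
      simp only [List.mem_cons, Prod.mk.injEq] at hw
      rcases hw with ⟨h1, _⟩ | hw
      · have : j = i := by
          ext
          omega
        exact (List.nodup_cons.1 hl).1 (this ▸ hj)
      · exact hπ j (by simp [hj]) w hw
  refine this _ (List.nodup_finRange k) π ?_
  intro i _ w hw
  have := hf _ _ hw
  omega

theorem Runs.retr {d : ℕ} (a hs : Fin k → Pos t) :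
    Runs (Frag.retr d : Frag Sig k Unit) t (hs, push d a π) () (hs, π) := by
  have : ∀ l : List (Fin k), ∀ π : List (ℕ × Pos t), 
      Runs (Frag.retrL d l : Frag Sig k Unit) t (hs, pushL d a l π) () (hs, π) := by
    intro l
    induction l with
    | nil => exact fun _ => Runs.ret _ _
    | cons i l ih =>
      intro π
      exact (ih _).bind (Runs.doI ⟨rfl, _, rfl⟩)
  exact this _ π

/-- Evaluate a test and return to the original head positions. -/
def Nx.evalAt (d : ℕ) (F : Frag Sig k Bool) : Frag Sig k Bool :=
  (Frag.drop d).bind fun _ => F.bind fun b => (X.goto (blk k d)).bind fun _ =>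
    (Frag.retr d).bind fun _ => .ret b

theorem Nx.dec_evalAt {d : ℕ} (hf : Fresh π d) {F : Frag Sig k Bool} {hs : Fin k → Pos t} {P : Prop}
    (h : WDec F t (hs, push d hs π) P) : Dec (X.evalAt d F) t (hs, π) P := by
  intro b hb
  obtain ⟨hs', h⟩ := h b hb
  exact (Runs.drop hf hs).bind (h.bind ((X.runs_goto (Rep.blk hf hs) hs').bind
    ((Runs.retr hs hs).bind (Runs.ret _ _))))

end Combinators
end NestedPebbles

namespace NestedPebbles
section Sipser
open Relation
variable {T : Type} (rk : T → ℕ) (R : T → T → Prop) (u v : T)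

/-- Steps of the backward depth-first search from `v` for `u`. The mode is `true` when
arriving at a node for the first time, and `false` when its subtree is finished. -/
inductive AStep : Bool × T → Bool × T → Prop
  | child (x y : T) (hx : x ≠ u) (hy : R y x) (hv : y ≠ v)
      (hm : ∀ z, z ≠ v ∧ R z x → rk y ≤ rk z) : AStep (true, x) (true, y)
  | leaf (x : T) (hx : x ≠ u) (hm : ∀ z, ¬ (z ≠ v ∧ R z x)) : AStep (true, x) (false, x)
  | sibling (x p z : T) (hx : x ≠ v) (hp : R x p) (hz : R z p) (hv : z ≠ v) (hlt : rk x < rk z)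
      (hm : ∀ w, rk x < rk w → w ≠ v ∧ R w p → rk z ≤ rk w) : AStep (false, x) (true, z)
  | parent (x p : T) (hx : x ≠ v) (hp : R x p) (hm : ∀ w, rk x < rk w → ¬ (w ≠ v ∧ R w p)) :
      AStep (false, x) (false, p)

variable {rk R u v}

theorem exists_min (rk : T → ℕ) {P : T → Prop} (h : ∃ x, P x) : ∃ x, P x ∧ ∀ y, P y → rk x ≤ rk y := by
  obtain ⟨x, hx, hm⟩ := WellFounded.has_min (measure rk).wf {x | P x} h
  exact ⟨x, hx, fun y hy => not_lt.1 (hm y hy)⟩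

theorem sipser [Finite T] (hrk : Function.Injective rk) (hR : ∀ a b c, R a b → R a c → b = c) :
    (ReflTransGen R u v → ReflTransGen (AStep rk R u v) (true, v) (true, u)) ∧
    (¬ ReflTransGen R u v → ReflTransGen (AStep rk R u v) (true, v) (false, v)) := by
  obtain ⟨g, hg⟩ : ∃ g : T → T → Prop, ∀ y x, g y x ↔ y ≠ v ∧ R y x := ⟨_, fun _ _ => Iff.rfl⟩
  have hRg : ReflTransGen R u v ↔ ReflTransGen g u v := by
    constructor
    · intro h
      induction h using ReflTransGen.head_induction_on with
      | refl => exact .refl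
      | @head a c h1 _ ih =>
        by_cases ha : a = v
        · rw [ha]
        · exact .head ((hg _ _).2 ⟨ha, h1⟩) ih
    · exact fun h => ReflTransGen.mono (fun a b h => ((hg _ _).1 h).2) _ _ h
  have hirr : ∀ x, ReflTransGen g x v → ¬ TransGen g x x := by
    intro x h
    induction h using ReflTransGen.head_induction_on with
    | refl =>
      intro h
      obtain ⟨c, h, _⟩ := TransGen.head'_iff.1 h
      exact ((hg _ _).1 h).1 rfl
    | @head a c h1 h2 ih =>
      intro h
      obtain ⟨c', h3, h4⟩ := TransGen.head'_iff.1 h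
      obtain rfl := hR _ _ _ ((hg _ _).1 h1).2 ((hg _ _).1 h3).2
      exact ih (TransGen.tail' h4 h1)
  have wf : WellFounded (fun y x => TransGen g y x ∧ ReflTransGen g x v) := by
    have : IsTrans T (fun y x => TransGen g y x ∧ ReflTransGen g x v) :=
      ⟨fun a b c h1 h2 => ⟨h1.1.trans h2.1, h2.2⟩⟩
    have : Std.Irrefl (fun y x => TransGen g y x ∧ ReflTransGen g x v) :=
      ⟨fun a h => hirr a h.2 h.1⟩
    exact Finite.wellFounded_of_trans_of_irrefl _
  obtain ⟨M, hM⟩ : ∃ M, ∀ a, rk a ≤ M := by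
    obtain ⟨M, hM⟩ := (Set.finite_range rk).bddAbove
    exact ⟨M, fun a => hM ⟨a, rfl⟩⟩
  have main : ∀ x, ReflTransGen g x v →
      (ReflTransGen g u x → ReflTransGen (AStep rk R u v) (true, x) (true, u)) ∧
      (¬ ReflTransGen g u x → ReflTransGen (AStep rk R u v) (true, x) (false, x)) := by
    intro x
    induction x using wf.induction with
    | _ x ih =>
    intro hx
    by_cases hxu : x = u
    · subst hxu
      exact ⟨fun _ => .refl, fun h => absurd .refl h⟩
    have inner : ∀ n y, M - rk y = n → g y x →
        ((∃ z, rk y ≤ rk z ∧ g z x ∧ ReflTransGen g u z) →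
          ReflTransGen (AStep rk R u v) (true, y) (true, u)) ∧
        ((¬ ∃ z, rk y ≤ rk z ∧ g z x ∧ ReflTransGen g u z) →
          ReflTransGen (AStep rk R u v) (true, y) (false, x)) := by
      intro n
      induction n using Nat.strong_induction_on with
      | _ n ihn =>
      intro y hn hy
      have ihy := ih y ⟨.single hy, hx⟩ (.head hy hx)
      have hy' := (hg _ _).1 hy
      by_cases huy : ReflTransGen g u y
      · exact ⟨fun _ => ihy.1 huy, fun h => absurd ⟨y, le_refl _, hy, huy⟩ h⟩
      have h1 := ihy.2 huy
      by_cases hs : ∃ z, rk y < rk z ∧ g z x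
      · obtain ⟨z, ⟨hyz, hz⟩, hzm⟩ := exists_min rk hs
        have hz' := (hg _ _).1 hz
        have hMz := hM z
        have ihz := ihn _ (by omega) z rfl hz
        have h2 := h1.tail (AStep.sibling y x z hy'.1 hy'.2 hz'.2 hz'.1 hyz
          (fun w hw1 hw2 => hzm w ⟨hw1, (hg _ _).2 hw2⟩))
        have hiff : (∃ z, rk y ≤ rk z ∧ g z x ∧ ReflTransGen g u z) →
            ∃ w, rk z ≤ rk w ∧ g w x ∧ ReflTransGen g u w := by
          rintro ⟨w, hw1, hw2, hw3⟩
          refine ⟨w, ?_, hw2, hw3⟩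
          rcases hw1.lt_or_eq with h | h
          · exact hzm w ⟨h, hw2⟩
          · exact absurd (hrk h ▸ hw3) huy
        refine ⟨fun h => h2.trans (ihz.1 (hiff h)), fun h => h2.trans (ihz.2 ?_)⟩
        rintro ⟨w, hw1, hw2⟩
        exact h ⟨w, by omega, hw2⟩
      · have h2 := h1.tail (AStep.parent y x hy'.1 hy'.2 (fun w hw1 hw2 => hs ⟨w, hw1, (hg _ _).2 hw2⟩))
        refine ⟨?_, fun _ => h2⟩
        rintro ⟨w, hw1, hw2, hw3⟩
        rcases hw1.lt_or_eq with h | h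
        · exact absurd ⟨w, h, hw2⟩ hs
        · exact absurd (hrk h ▸ hw3) huy
    by_cases hc : ∃ y, g y x
    · obtain ⟨y, hy, hym⟩ := exists_min rk hc
      have hy' := (hg _ _).1 hy
      have h1 : AStep rk R u v (true, x) (true, y) := .child x y hxu hy'.2 hy'.1
        fun z hz => hym z ((hg _ _).2 hz)
      have h2 := inner _ y rfl hy
      constructor
      · intro hux
        refine .head h1 (h2.1 ?_)
        rcases ReflTransGen.cases_tail hux with h | ⟨z, hz1, hz2⟩
        · exact absurd h hxu
        · exact ⟨z, hym z hz2, hz2, hz1⟩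
      · intro hux
        refine .head h1 (h2.2 ?_)
        rintro ⟨z, _, hz1, hz2⟩
        exact hux (hz2.tail hz1)
    · constructor
      · intro hux
        rcases ReflTransGen.cases_tail hux with h | ⟨z, hz1, hz2⟩
        · exact absurd h hxu
        · exact absurd ⟨z, hz2⟩ hc
      · intro _
        exact .single (.leaf x hxu fun z hz => hc ⟨z, (hg _ _).2 hz⟩)
  rw [hRg]
  exact main v .refl
end Sipser
end NestedPebbles

namespace NestedPebbles
section TCProgram
variable {Sig : Type} {rank : Sig → ℕ} {k : ℕ} [NeZero k] (X : Nx Sig rank k)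

/-- Test that the heads are not on the tuple `vs` and that `F` holds. -/
def Nx.candF (vs : Fin k → ℕ) (d : ℕ) (F : Frag Sig k Bool) : Frag Sig k Bool :=
  (Frag.atF vs).notF.andF (X.evalAt d F)

def Nx.arriveF (us vs : Fin k → ℕ) (d : ℕ) (F1 : Frag Sig k Bool) : Frag Sig k (Bool ⊕ Bool) :=
  (Frag.atF us).bind fun b => match b with
    | true => .ret (.inr true)
    | false => (Frag.drop d).bind fun _ => (X.find (X.candF vs (d + k) F1)).bind fun b => match b with
      | true => (Frag.retr d).bind fun _ => .ret (.inl true)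
      | false => (X.goto (blk k d)).bind fun _ => (Frag.retr d).bind fun _ => .ret (.inl false)

def Nx.sibF (vs : Fin k → ℕ) (d : ℕ) (F3 : Frag Sig k Bool) : Frag Sig k Bool :=
  X.F.bind fun b => match b with
    | true => X.search (X.candF vs (d + k + k) F3)
    | false => .ret false

def Nx.finishedF (vs : Fin k → ℕ) (d : ℕ) (F2 F3 : Frag Sig k Bool) : Frag Sig k (Bool ⊕ Bool) :=
  (Frag.atF vs).bind fun b => match b with
    | true => .ret (.inr false)
    | false => (Frag.drop d).bind fun _ => (X.find (X.evalAt (d + k) F2)).bind fun _ =>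
      (Frag.drop (d + k)).bind fun _ => (X.goto (blk k d)).bind fun _ =>
      (X.sibF vs d F3).bind fun b => match b with
        | true => (Frag.retr (d + k)).bind fun _ => (Frag.retr d).bind fun _ => .ret (.inl true)
        | false => (X.goto (blk k (d + k))).bind fun _ => (Frag.retr (d + k)).bind fun _ =>
          (Frag.retr d).bind fun _ => .ret (.inl false)

def Nx.tcF (us vs : Fin k → ℕ) (d : ℕ) (F1 F2 F3 : Frag Sig k Bool) : Frag Sig k Bool :=
  (X.goto vs).bind fun _ => Frag.iter (fun b => match b with
    | true => X.arriveF us vs d F1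
    | false => X.finishedF vs d F2 F3) true

variable {t : RTree Sig rank} {π : List (ℕ × Pos t)}

theorem Nx.dec_cand {vs : Fin k → ℕ} {v : Fin k → Pos t} (hv : Rep vs v π) {d : ℕ} (hf : Fresh π d)
    {F : Frag Sig k Bool} {hs : Fin k → Pos t} {P : Prop} (h : WDec F t (hs, push d hs π) P) :
    Dec (X.candF vs d F) t (hs, π) (hs ≠ v ∧ P) :=
  (hv.atF hs).notF.andF fun _ => X.dec_evalAt hf h

theorem Runs.iter_rtg {S : Type} [Finite S] {E : Type} {B : S → Frag Sig k (S ⊕ E)}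
    {A : S × (Fin k → Pos t) → S × (Fin k → Pos t) → Prop}
    (hA : ∀ s a s' a', A (s, a) (s', a') → Runs (B s) t (a, π) (.inl s') (a', π))
    {x y : S × (Fin k → Pos t)} (h : Relation.ReflTransGen A x y) {e : E} {c : HC k t}
    (hy : Runs (B y.1) t (y.2, π) (.inr e) c) : Runs (Frag.iter B x.1) t (x.2, π) e c := by
  induction h using Relation.ReflTransGen.head_induction_on with
  | refl => exact Runs.iter_exit hy
  | head h1 _ ih => exact Runs.iter_step (hA _ _ _ _ h1) ih

theorem Nx.wdec_tc {us vs : Fin k → ℕ} {u v : Fin k → Pos t} (hu : Rep us u π) (hv : Rep vs v π)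
    {d : ℕ} (hf : Fresh π d) {R : (Fin k → Pos t) → (Fin k → Pos t) → Prop}
    (hR : ∀ a b c, R a b → R a c → b = c)
    {F1 F2 F3 : Frag Sig k Bool}
    (h1 : ∀ x y, WDec F1 t (y, push (d + k) y (push d x π)) (R y x))
    (h2 : ∀ x p, WDec F2 t (p, push (d + k) p (push d x π)) (R x p))
    (h3 : ∀ x p z : Fin k → Pos t, WDec F3 t (z, push (d + k + k) z (push (d + k) p (push d x π))) (R z p))
    (hs : Fin k → Pos t) :
    WDec (X.tcF us vs d F1 F2 F3) t (hs, π) (Relation.ReflTransGen R u v) := by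
  have hA : ∀ s a s' a', AStep (X.rk t) R u v (s, a) (s', a') → Runs (match s with
    | true => X.arriveF us vs d F1
    | false => X.finishedF vs d F2 F3) t (a, π) (.inl s') (a', π) := by
    intro s x s' y hst
    have hv1 := hv.push hf x
    have hf1 := hf.push x
    have hb1 := Rep.blk hf x
    have hd1 := Runs.drop (Sig := Sig) hf x
    have hfind := X.find_spec (fun y => X.dec_cand hv1 hf1 (h1 x y)) x
    have hsib : ∀ p, R x p → x ≠ v → Runs (X.find (X.evalAt (d + k) F2)) t (x, push d x π) true
        (p, push d x π) := by
      intro p hp hx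
      exact X.find_unique (fun y => X.dec_evalAt hf1 (h2 x y)) x p fun c =>
        ⟨fun h => hR _ _ _ h hp, fun h => h ▸ hp⟩
    cases hst with
    | child x y hx hy hyv hm =>
      refine (hu.atF x false (by simp [hx])).bind (hd1.bind ?_)
      rcases hfind with ⟨b, g1, g2, g3⟩ | ⟨g1, g2⟩
      · have : b = y := X.inj t (le_antisymm (g2 y ⟨hyv, hy⟩) (hm b g1))
        subst this
        exact g3.bind ((Runs.retr _ _).bind (Runs.ret _ _))
      · exact absurd ⟨hyv, hy⟩ (g1 y)
    | leaf x hx hm =>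
      refine (hu.atF x false (by simp [hx])).bind (hd1.bind ?_)
      rcases hfind with ⟨b, g1, g2, g3⟩ | ⟨g1, g2⟩
      · exact absurd g1 (hm b)
      · exact g2.bind ((X.runs_goto hb1 _).bind ((Runs.retr _ _).bind (Runs.ret _ _)))
    | sibling x p z hx hp hz hzv hlt hm =>
      refine (hv.atF x false (by simp [hx])).bind (hd1.bind ((hsib p hp hx).bind ?_))
      have hv2 := hv1.push hf1 p
      have hf2 := hf1.push p
      refine (Runs.drop hf1 p).bind ((X.runs_goto (hb1.push hf1 p) p).bind ?_)
      have : Runs (X.sibF vs d F3) t (x, push (d + k) p (push d x π)) true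
          (y, push (d + k) p (push d x π)) := by
        rcases X.spec t x (push (d + k) p (push d x π)) with ⟨b, k1, k2⟩ | ⟨k1, k2⟩
        · refine k2.bind ?_
          rcases X.search_spec (fun y => X.dec_cand hv2 hf2 (h3 x p y)) b with
            ⟨c, g0, g1, g2, g3⟩ | ⟨g1, g2⟩
          · have : c = y := X.inj t (le_antisymm (g2 y (by omega) ⟨hzv, hz⟩) (hm c (by omega) g1))
            subst this
            exact g3
          · exact absurd ⟨hzv, hz⟩ (g1 y (by omega))
        · have := k1 y
          omega
      exact this.bind ((Runs.retr _ _).bind ((Runs.retr _ _).bind (Runs.ret _ _)))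
    | parent x p hx hp hm =>
      refine (hv.atF x false (by simp [hx])).bind (hd1.bind ((hsib y hp hx).bind ?_))
      have hv2 := hv1.push hf1 y
      have hf2 := hf1.push y
      refine (Runs.drop hf1 y).bind ((X.runs_goto (hb1.push hf1 y) y).bind ?_)
      have : Runs (X.sibF vs d F3) t (x, push (d + k) y (push d x π)) false
          (fun _ => rootPos t, push (d + k) y (push d x π)) := by
        rcases X.spec t x (push (d + k) y (push d x π)) with ⟨b, k1, k2⟩ | ⟨k1, k2⟩
        · refine k2.bind ?_
          rcases X.search_spec (fun z => X.dec_cand hv2 hf2 (h3 x y z)) b with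
            ⟨c, g0, g1, g2, g3⟩ | ⟨g1, g2⟩
          · exact absurd g1 (hm c (by omega))
          · exact g2
        · exact k2.bind (Runs.ret _ _)
      exact this.bind ((X.runs_goto (Rep.blk hf1 y) _).bind
        ((Runs.retr _ _).bind ((Runs.retr _ _).bind (Runs.ret _ _))))
  obtain ⟨s1, s2⟩ := sipser (rk := X.rk t) (u := u) (v := v) (X.inj t) hR
  intro b hb
  by_cases h : Relation.ReflTransGen R u v
  · have : b = true := by simp [hb, h]
    subst this
    exact ⟨u, (X.runs_goto hv hs).bind (Runs.iter_rtg hA (s1 h)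
      ((hu.atF u true (by simp)).bind (Runs.ret _ _)))⟩
  · have : b = false := by
      rw [← Bool.not_eq_true, hb]
      exact h
    subst this
    exact ⟨v, (X.runs_goto hv hs).bind (Runs.iter_rtg hA (s2 h)
      ((hv.atF v true (by simp)).bind (Runs.ret _ _)))⟩

end TCProgram
end NestedPebbles

namespace NestedPebbles
section Eval
variable {Sig : Type} {rank : Sig → ℕ} {k : ℕ} [NeZero k] (X : Nx Sig rank k)

/-- Move head `0` to pebble `p`. -/
def Nx.seek (p : ℕ) : Frag Sig k Unit := (X.find (Frag.tst (.peb 0 p))).bind fun _ => .ret ()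

variable {t : RTree Sig rank} {π : List (ℕ × Pos t)}

theorem Nx.runs_seek {e : ℕ → ℕ} {ν : ℕ → Pos t} (h : Rep e ν π) (x : ℕ) (hs : Fin k → Pos t) :
    ∃ hs', hs' 0 = ν x ∧ Runs (X.seek (e x)) t (hs, π) () (hs', π) := by
  rcases X.find_spec (G := Frag.tst (.peb 0 (e x))) (P := fun b => b 0 = ν x) (π := π)
    (fun b => (Dec.tst (.peb 0 (e x)) (b, π)).congr (h x (b 0)).symm) hs with ⟨b, h1, _, h3⟩ | ⟨h1, _⟩
  · exact ⟨b, h1, h3.bind (Runs.ret _ _)⟩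
  · exact absurd rfl (h1 fun _ => ν x)

theorem Nx.wdec_seek {e : ℕ → ℕ} {ν : ℕ → Pos t} (h : Rep e ν π) (x : ℕ) (hs : Fin k → Pos t)
    {F : Frag Sig k Bool} {P : Prop} (hF : ∀ hs', hs' 0 = ν x → WDec F t (hs', π) P) :
    WDec ((X.seek (e x)).bind fun _ => F) t (hs, π) P := by
  obtain ⟨hs', h1, h2⟩ := X.runs_seek h x hs
  intro b hb
  obtain ⟨hs'', h3⟩ := hF hs' h1 b hb
  exact ⟨hs'', h2.bind h3⟩

def Frag.ancF (p : ℕ) : Frag Sig k Bool :=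
  Frag.iter (S := Unit) (fun _ => (Frag.tst (.peb 0 p)).bind fun b => match b with
    | true => .ret (.inr true)
    | false => (Frag.tst (.chno 0 0)).bind fun b => match b with
      | true => .ret (.inr false)
      | false => (Frag.doI (.up 0)).bind fun _ => .ret (.inl ())) ()

theorem wdec_anc {e : ℕ → ℕ} {ν : ℕ → Pos t} (h : Rep e ν π) (x : ℕ) (c : List ℕ) :
    ∀ hs : Fin k → Pos t, (hs 0).1 = c →
      WDec (Frag.ancF (e x) : Frag Sig k Bool) t (hs, π) ((ν x).1 <+: c) := by
  induction c using List.reverseRecOn with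
  | nil =>
    intro hs hc b hb
    have d1 := (Dec.tst (.peb 0 (e x)) (hs, π) : Dec (Frag.tst (Sig := Sig) _) t _ _)
    have e1 : testHolds t (.peb (Sig := Sig) 0 (e x)) hs π ↔ (ν x).1 = [] := by
      refine (h x (hs 0)).trans ?_
      rw [← hc]
      exact ⟨fun h => by rw [h], fun h => Subtype.ext h.symm⟩
    refine ⟨hs, ?_⟩
    cases b with
    | true =>
      have hx : (ν x).1 = [] := by simpa using hb
      exact Runs.iter_exit ((d1 true (by simp [e1, hx])).bind (Runs.ret _ _))
    | false =>
      have hx : ¬ (ν x).1 = [] := by simpa using hb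
      refine Runs.iter_exit ((d1 false (by simp [e1, hx])).bind
        (((Dec.tst (.chno 0 0) (hs, π)) true ?_).bind (Runs.ret _ _)))
      simp [testHolds, hc, childNo_nil]
  | append_singleton c j ih =>
    intro hs hc b hb
    have d1 := (Dec.tst (.peb 0 (e x)) (hs, π) : Dec (Frag.tst (Sig := Sig) _) t _ _)
    have e1 : testHolds t (.peb (Sig := Sig) 0 (e x)) hs π ↔ (ν x).1 = c ++ [j] := by
      refine (h x (hs 0)).trans ?_
      rw [← hc]
      exact ⟨fun h => by rw [h], fun h => Subtype.ext h.symm⟩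
    by_cases hx : (ν x).1 = c ++ [j]
    · have : b = true := by simp [hb, hx]
      subst this
      exact ⟨hs, Runs.iter_exit ((d1 true (by simp [e1, hx])).bind (Runs.ret _ _))⟩
    · have hpos := (hs 0).2
      rw [hc] at hpos
      obtain ⟨C, hC⟩ : ∃ C : Pos t, C.1 = c := ⟨⟨c, isPos_initial hpos⟩, rfl⟩
      obtain ⟨hs', h'⟩ := ih (Function.update hs 0 C) (by rw [Function.update_self, hC]) b
        (by rw [hb, List.prefix_concat_iff]; simp [hx])
      refine ⟨hs', Runs.iter_step ((d1 false (by simp [e1, hx])).bind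
        (((Dec.tst (.chno 0 0) (hs, π)) false ?_).bind ((Runs.up C j (by rw [hc, hC])).bind (Runs.ret _ _)))) h'⟩
      simp [testHolds, hc, childNo_snoc]

theorem Nx.wdec_ex {d : ℕ} (hf : Fresh π d) {F : Frag Sig k Bool} {P : Pos t → Prop}
    (h : ∀ hs : Fin k → Pos t, WDec F t (hs, push d hs π) (P (hs 0))) (hs : Fin k → Pos t) :
    WDec (X.find (X.evalAt d F)) t (hs, π) (∃ u, P u) := by
  intro b hb
  rcases X.find_spec (fun b => X.dec_evalAt hf (h b)) hs with ⟨c, h1, _, h3⟩ | ⟨h1, h2⟩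
  · have : b = true := hb.2 ⟨_, h1⟩
    subst this
    exact ⟨_, h3⟩
  · have : b = false := by
      rw [← Bool.not_eq_true, hb]
      rintro ⟨u, hu⟩
      exact h1 (fun _ => u) hu
    subst this
    exact ⟨_, h2⟩

theorem Nx.eval (X : Nx Sig rank k) (φ : TForm Sig rank k) : DetTC φ → ∀ (d : ℕ) (e : ℕ → ℕ), ∃ F : Frag Sig k Bool,
    ∀ (t : RTree Sig rank) (ν : ℕ → Pos t) (hs : Fin k → Pos t) (π : List (ℕ × Pos t)),
      Fresh π d → Rep e ν π → WDec F t (hs, π) (Sat t φ ν) := by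
  induction φ with
  | lab a x =>
    intro _ d e
    refine ⟨(X.seek (e x)).bind fun _ => Frag.tst (.lab 0 a), fun t ν hs π hf hr =>
      X.wdec_seek hr x hs fun hs' h => (Dec.tst _ _).wdec.congr ?_⟩
    simp [testHolds, Sat, h]
  | eq x y =>
    intro _ d e
    refine ⟨(X.seek (e x)).bind fun _ => Frag.tst (.peb 0 (e y)), fun t ν hs π hf hr =>
      X.wdec_seek hr x hs fun hs' h => (Dec.tst _ _).wdec.congr ?_⟩
    refine Iff.trans ?_ (hr y (hs' 0)).symm
    rw [h]
    exact Iff.rfl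
  | le x y =>
    intro _ d e
    refine ⟨(X.seek (e y)).bind fun _ => Frag.ancF (e x), fun t ν hs π hf hr =>
      X.wdec_seek hr y hs fun hs' h => wdec_anc hr x _ hs' (by rw [h])⟩
  | edg i x y =>
    intro _ d e
    cases i with
    | zero =>
      refine ⟨.ret false, fun t ν hs π hf hr => (Dec.ret_false _).wdec.congr ?_⟩
      simp [Sat]
    | succ j =>
      refine ⟨(X.seek (e y)).bind fun _ => (Frag.tst (.chno 0 (j + 1))).andF
        ((Frag.doI (.up 0)).bind fun _ => Frag.tst (.peb 0 (e x))), fun t ν hs π hf hr =>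
        X.wdec_seek hr y hs fun hs' h => ?_⟩
      intro b hb
      by_cases hc : childNo (ν y).1 = j + 1
      · obtain ⟨q, hq⟩ := childNo_eq_succ.1 hc
        have hpos := (ν y).2
        rw [hq] at hpos
        obtain ⟨C, hC⟩ : ∃ C : Pos t, C.1 = q := ⟨⟨q, isPos_initial hpos⟩, rfl⟩
        refine ⟨Function.update hs' 0 C, ?_⟩
        refine ((Dec.tst (.chno 0 (j + 1)) (hs', π)) true ?_).bind
          ((Runs.up C j (by rw [h, hq, hC])).bind ((Dec.tst (.peb 0 (e x)) _) b ?_))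
        · simp [testHolds, h, hc]
        · refine hb.trans ?_
          refine Iff.trans ?_ (hr x _).symm
          show _ ↔ (Function.update hs' 0 C) 0 = ν x
          rw [Function.update_self]
          simp only [Sat, hq, Nat.add_sub_cancel, List.append_cancel_right_eq]
          rw [← hC]
          exact ⟨fun h => Subtype.ext h.2, fun h => ⟨by omega, by rw [h]⟩⟩
      · refine ⟨hs', ?_⟩
        have : b = false := by
          rw [← Bool.not_eq_true, hb]
          rintro ⟨_, h2⟩
          apply hc
          rw [h2, childNo_snoc]
          omega
        subst this
        refine ((Dec.tst (.chno 0 (j + 1)) (hs', π)) false ?_).bind (Runs.ret _ _)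
        simp [testHolds, h, hc]
  | not φ ih =>
    intro hD d e
    obtain ⟨F, hF⟩ := ih hD d e
    exact ⟨F.notF, fun t ν hs π hf hr => (hF t ν hs π hf hr).notF⟩
  | and φ ψ ih1 ih2 =>
    intro hD d e
    obtain ⟨F, hF⟩ := ih1 hD.1 d e
    obtain ⟨G, hG⟩ := ih2 hD.2 d e
    exact ⟨F.andF G, fun t ν hs π hf hr =>
      (hF t ν hs π hf hr).andF fun _ hs' => hG t ν hs' π hf hr⟩
  | or φ ψ ih1 ih2 =>
    intro hD d e
    obtain ⟨F, hF⟩ := ih1 hD.1 d e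
    obtain ⟨G, hG⟩ := ih2 hD.2 d e
    refine ⟨(F.notF.andF G.notF).notF, fun t ν hs π hf hr =>
      ((hF t ν hs π hf hr).notF.andF fun _ hs' => (hG t ν hs' π hf hr).notF).notF.congr ?_⟩
    simp only [Sat]
    tauto
  | ex x φ ih =>
    intro hD d e
    obtain ⟨F, hF⟩ := ih hD (d + k) (Function.update e x (blk k d 0))
    refine ⟨X.find (X.evalAt d F), fun t ν hs π hf hr => X.wdec_ex hf (fun hs' => ?_) hs⟩
    exact hF t _ hs' _ (hf.push hs') ((hr.push hf hs').update (Rep.blk hf hs') x 0)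
  | all x φ ih =>
    intro hD d e
    obtain ⟨F, hF⟩ := ih hD (d + k) (Function.update e x (blk k d 0))
    refine ⟨(X.find (X.evalAt d F.notF)).notF, fun t ν hs π hf hr =>
      (X.wdec_ex (P := fun u => ¬ Sat t φ (Function.update ν x u)) hf (fun hs' => ?_) hs).notF.congr ?_⟩
    · exact (hF t _ hs' _ (hf.push hs') ((hr.push hf hs').update (Rep.blk hf hs') x 0)).notF
    · simp [Sat]
  | tc xs ys φ us vs ih =>
    intro hD d e
    obtain ⟨hfun, hD⟩ := hD
    obtain ⟨F1, hF1⟩ := ih hD (d + k + k) (updVec (updVec e xs (blk k (d + k))) ys (blk k d))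
    obtain ⟨F2, hF2⟩ := ih hD (d + k + k) (updVec (updVec e xs (blk k d)) ys (blk k (d + k)))
    obtain ⟨F3, hF3⟩ := ih hD (d + k + k + k)
      (updVec (updVec e xs (blk k (d + k + k))) ys (blk k (d + k)))
    refine ⟨X.tcF (fun i => e (us i)) (fun i => e (vs i)) d F1 F2 F3, fun t ν hs π hf hr =>
      X.wdec_tc (hr.comp us) (hr.comp vs) hf (fun a b c => hfun t ν a b c) ?_ ?_ ?_ hs⟩
    · intro x y
      have f1 := hf.push x
      exact hF1 t _ _ _ (f1.push y) ((((hr.push hf x).push f1 y).updVec (Rep.blk f1 y) xs).updVec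
        ((Rep.blk hf x).push f1 y) ys)
    · intro x y
      have f1 := hf.push x
      exact hF2 t _ _ _ (f1.push y) ((((hr.push hf x).push f1 y).updVec
        ((Rep.blk hf x).push f1 y) xs).updVec (Rep.blk f1 y) ys)
    · intro x y z
      have f1 := hf.push x
      have f2 := f1.push y
      exact hF3 t _ _ _ (f2.push z) (((((hr.push hf x).push f1 y).push f2 z).updVec
        (Rep.blk f2 z) xs).updVec ((Rep.blk f1 y).push f2 z) ys)

end Eval
end NestedPebbles

namespace NestedPebbles
section Convert
variable {Sig : Type} {rank : Sig → ℕ} {k : ℕ}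

def TTest.pm : TTest Sig k ℕ → ℕ
  | .peb _ x => x
  | _ => 0

def TInstr.pm : TInstr Sig k ℕ → ℕ
  | .dropPeb _ x => x
  | .retrieve x => x
  | .test _ τ => τ.pm
  | _ => 0

def Act.pm {S : Type} : Act Sig k S → ℕ
  | .ins χ _ => χ.pm
  | .tst τ _ _ => τ.pm

def TTest.mapP {X Y : Type} (f : X → Y) : TTest Sig k X → TTest Sig k Y
  | .lab i a => .lab i a
  | .peb i x => .peb i (f x)
  | .chno i j => .chno i j

def TInstr.mapP {X Y : Type} (f : X → Y) : TInstr Sig k X → TInstr Sig k Y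
  | .up i => .up i
  | .down i j => .down i j
  | .dropPeb i x => .dropPeb i (f x)
  | .retrieve x => .retrieve (f x)
  | .test b τ => .test b (τ.mapP f)

def Act.instrs {S : Type} : Act Sig k S → Set (TInstr Sig k ℕ × S)
  | .ins χ s => {(χ, s)}
  | .tst τ s1 s0 => {(.test true τ, s1), (.test false τ, s0)}

theorem Act.instrs_finite {S : Type} (a : Act Sig k S) : a.instrs.Finite := by
  cases a <;> simp [Act.instrs]

/-- The truncation of pebble numbers. -/
def cut (N : ℕ) (x : ℕ) : Fin (N + 1) := Fin.ofNat (N + 1) x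

theorem cut_inj {N x y : ℕ} (hx : x ≤ N) (hy : y ≤ N) (h : cut N x = cut N y) : x = y := by
  have := congrArg Fin.val h
  simp only [cut, Fin.ofNat, Nat.mod_eq_of_lt (Nat.lt_succ_of_le hx),
    Nat.mod_eq_of_lt (Nat.lt_succ_of_le hy)] at this
  exact this

noncomputable def Frag.toTWA (rank : Sig → ℕ) (N : ℕ) (F : Frag Sig k Bool)  : TWA Sig rank k where
  Q := F.Q ⊕ Bool
  finQ := by
    have := F.fin
    exact Fintype.ofFinite _
  X := Fin (N + 1)
  finX := inferInstance
  q0 := .inl F.start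
  acc := {.inr true}
  instr := ⋃ q : F.Q, (fun z => (.inl q, z.1.mapP (cut N), z.2)) '' (F.δ q).instrs
  instrFin := by
    have := F.fin
    exact Set.finite_iUnion fun q => (Act.instrs_finite _).image _

theorem Frag.toTWA_det (N : ℕ) (F : Frag Sig k Bool) : Deterministic (F.toTWA rank N) := by
  intro p χ1 q1 χ2 q2 h1 h2 hne
  obtain ⟨p1, ⟨a1, b1⟩, g1, e1⟩ := Set.mem_iUnion.1 h1
  obtain ⟨p2, ⟨a2, b2⟩, g2, e2⟩ := Set.mem_iUnion.1 h2
  obtain ⟨rfl, rfl, rfl⟩ := e1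
  obtain ⟨rfl, rfl, rfl⟩ := e2
  cases hδ : F.δ p1 with
  | ins χ s =>
    rw [hδ] at g1 g2
    simp only [Act.instrs, Set.mem_singleton_iff, Prod.mk.injEq] at g1 g2
    obtain ⟨rfl, rfl⟩ := g1
    obtain ⟨rfl, rfl⟩ := g2
    exact absurd rfl hne
  | tst τ s1 s0 =>
    rw [hδ] at g1 g2
    simp only [Act.instrs, Set.mem_insert_iff, Set.mem_singleton_iff, Prod.mk.injEq] at g1 g2
    rcases g1 with ⟨rfl, rfl⟩ | ⟨rfl, rfl⟩ <;> rcases g2 with ⟨rfl, rfl⟩ | ⟨rfl, rfl⟩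
    · exact absurd rfl hne
    · exact Or.inl ⟨true, _, rfl, rfl⟩
    · exact Or.inl ⟨false, _, rfl, rfl⟩
    · exact absurd rfl hne

variable {t : RTree Sig rank}

def cutS (N : ℕ) (π : List (ℕ × Pos t)) : List (Fin (N + 1) × Pos t) := π.map (Prod.map (cut N) id)

theorem mem_cutS {N x : ℕ} {π : List (ℕ × Pos t)} {w : Pos t} (hx : x ≤ N) (hπ : ∀ x w, (x, w) ∈ π → x ≤ N) :
    (cut N x, w) ∈ cutS N π ↔ (x, w) ∈ π := by
  unfold cutS
  rw [List.mem_map]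
  constructor
  · rintro ⟨⟨y, w'⟩, h, e⟩
    simp only [Prod.map_apply, id, Prod.mk.injEq] at e
    obtain ⟨e1, rfl⟩ := e
    rw [← cut_inj (hπ _ _ h) hx e1]
    exact h
  · intro h
    exact ⟨_, h, rfl⟩

theorem test_cut {N : ℕ} {π : List (ℕ × Pos t)} (hπ : ∀ x w, (x, w) ∈ π → x ≤ N) {hs : Fin k → Pos t}
    {τ : TTest Sig k ℕ} (hτ : τ.pm ≤ N) :
    testHolds t (τ.mapP (cut N)) hs (cutS N π) ↔ testHolds t τ hs π := by
  cases τ with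
  | lab i a => exact Iff.rfl
  | chno i j => exact Iff.rfl
  | peb i x => exact mem_cutS hτ hπ

theorem instr_cut {N : ℕ} {π π' : List (ℕ × Pos t)} (hπ : ∀ x w, (x, w) ∈ π → x ≤ N)
    {hs hs' : Fin k → Pos t} {χ : TInstr Sig k ℕ} (hχ : χ.pm ≤ N) (h : instrStep t χ hs π hs' π') :
    instrStep t (χ.mapP (cut N)) hs (cutS N π) hs' (cutS N π') ∧ ∀ x w, (x, w) ∈ π' → x ≤ N := by
  cases χ with
  | up i =>
    obtain ⟨rfl, h⟩ := h
    exact ⟨⟨rfl, h⟩, hπ⟩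
  | down i j =>
    obtain ⟨rfl, h⟩ := h
    exact ⟨⟨rfl, h⟩, hπ⟩
  | dropPeb i x =>
    obtain ⟨rfl, rfl, h⟩ := h
    refine ⟨⟨rfl, rfl, fun w hw => h w ((mem_cutS hχ hπ).1 hw)⟩, ?_⟩
    intro y w hy
    rcases List.mem_cons.1 hy with hy | hy
    · rw [(Prod.mk.inj hy).1]
      exact hχ
    · exact hπ _ _ hy
  | retrieve x =>
    obtain ⟨rfl, w, rfl⟩ := h
    exact ⟨⟨rfl, w, rfl⟩, fun y w' hy => hπ y w' (List.mem_cons_of_mem _ hy)⟩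
  | test b τ =>
    obtain ⟨rfl, rfl, h⟩ := h
    exact ⟨⟨rfl, rfl, (test_cut hπ hχ).trans h⟩, hπ⟩

theorem toTWA_step {N : ℕ} {F : Frag Sig k Bool} (hN : ∀ q, (F.δ q).pm ≤ N)
    {s s' : F.Q ⊕ Bool} {hs hs' : Fin k → Pos t} {π π' : List (ℕ × Pos t)}
    (hπ : ∀ x w, (x, w) ∈ π → x ≤ N) (h : FStep t F.δ (s, hs, π) (s', hs', π')) :
    Step (F.toTWA rank N) t (s, hs, cutS N π) (s', hs', cutS N π') ∧ ∀ x w, (x, w) ∈ π' → x ≤ N := by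
  obtain ⟨q, hq, h⟩ := h
  simp only at hq
  subst hq
  have hb := hN q
  have key : ∀ χ, (χ, s') ∈ (F.δ q).instrs → χ.pm ≤ N → instrStep t χ hs π hs' π' →
      Step (F.toTWA rank N) t (.inl q, hs, cutS N π) (s', hs', cutS N π') ∧ ∀ x w, (x, w) ∈ π' → x ≤ N := by
    intro χ h1 h2 h3
    obtain ⟨h4, h5⟩ := instr_cut hπ h2 h3
    exact ⟨⟨_, Set.mem_iUnion.2 ⟨q, _, h1, rfl⟩, h4⟩, h5⟩
  cases hδ : F.δ q with
  | ins χ s =>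
    rw [hδ] at h hb
    obtain ⟨rfl, h⟩ := h
    refine key χ ?_ hb h
    rw [hδ]
    exact rfl
  | tst τ s1 s0 =>
    rw [hδ] at h hb
    obtain ⟨hc, h⟩ := h
    obtain ⟨rfl, rfl⟩ := Prod.mk.inj hc
    rcases h with ⟨h, rfl⟩ | ⟨h, rfl⟩
    · refine key (.test true τ) ?_ hb ⟨rfl, rfl, by simpa using h⟩
      rw [hδ]
      exact Or.inl rfl
    · refine key (.test false τ) ?_ hb ⟨rfl, rfl, by simpa using h⟩
      rw [hδ]
      exact Or.inr rfl

theorem toTWA_runs {N : ℕ} {F : Frag Sig k Bool} (hN : ∀ q, (F.δ q).pm ≤ N)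
    {b : Bool} (h : Runs F t (fun _ => rootPos t, []) b (fun _ => rootPos t, [])) :
    Relation.ReflTransGen (Step (F.toTWA rank N) t) (initConf (F.toTWA rank N) t)
      (.inr b, fun _ => rootPos t, []) := by
  have : ∀ x y : (F.Q ⊕ Bool) × HC k t, Relation.ReflTransGen (FStep t F.δ) x y →
      (∀ z w, (z, w) ∈ x.2.2 → z ≤ N) →
      Relation.ReflTransGen (Step (F.toTWA rank N) t) (x.1, x.2.1, cutS N x.2.2) (y.1, y.2.1, cutS N y.2.2) := by
    intro x y h
    induction h using Relation.ReflTransGen.head_induction_on with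
    | refl => exact fun _ => .refl
    | head h1 _ ih =>
      intro hx
      obtain ⟨g1, g2⟩ := toTWA_step hN hx h1
      exact .head g1 (ih g2)
  exact this _ _ h (by simp)

theorem toTWA_halt {N : ℕ} {F : Frag Sig k Bool} {b : Bool} {hs : Fin k → Pos t}
    {π : List (Fin (N + 1) × Pos t)} :
    HaltingConf (F.toTWA rank N) t (.inr b, hs, π) := by
  rintro c' ⟨ins, h, _⟩
  obtain ⟨q, z, _, e⟩ := Set.mem_iUnion.1 h
  have := (Prod.mk.inj e).1
  simp at this

theorem toTWA_accepts {N : ℕ} {F : Frag Sig k Bool} (hN : ∀ q, (F.δ q).pm ≤ N) {P : Prop}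
    (h : Dec F t (fun _ => rootPos t, []) P) : Accepts (F.toTWA rank N) t ↔ P := by
  constructor
  · rintro ⟨q, hq, h1, h2⟩
    obtain ⟨b, hb⟩ := exists_bool P
    have h3 := toTWA_runs hN (h b hb)
    have := rtg_normal_unique (fun a b c => Step.functional (F.toTWA_det N)) h1 h3 h2 toTWA_halt
    have e1 := (Prod.mk.inj this).1
    obtain rfl : q = .inr true := hq
    exact hb.1 (Sum.inr_injective e1).symm
  · intro hP
    exact ⟨.inr true, rfl, toTWA_runs hN (h true (by simp [hP])), toTWA_halt⟩

variable [NeZero k]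

theorem FODTC_subset [Finite Sig] : FODTC Sig rank k ⊆ DPTWA Sig rank k := by
  rintro L ⟨φ, _, hD, _, rfl⟩
  obtain ⟨X⟩ := exists_Nx (Sig := Sig) (rank := rank) (k := k)
  obtain ⟨F, hF⟩ := X.eval φ hD 1 (fun _ => 0)
  let G : Frag Sig k Bool := (Frag.doI (.dropPeb 0 0)).bind fun _ => F.bind fun b =>
    X.toRoot.bind fun _ => (Frag.doI (.retrieve 0)).bind fun _ => .ret b
  have hG : ∀ t : RTree Sig rank, Dec G t (fun _ => rootPos t, []) (Sat t φ fun _ => rootPos t) := by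
    intro t b hb
    obtain ⟨hs', h⟩ := hF t (fun _ => rootPos t) (fun _ => rootPos t) [(0, rootPos t)]
      (by
        intro x w h
        rw [List.mem_singleton] at h
        rw [(Prod.mk.inj h).1]
        omega)
      (by
        intro x w
        rw [List.mem_singleton]
        exact ⟨fun h => (Prod.mk.inj h).2, fun h => by rw [h]⟩) b hb
    have h1 : Runs (Frag.doI (Sig := Sig) (.dropPeb 0 0)) t ((fun _ => rootPos t : Fin k → Pos t), []) ()
        (fun _ => rootPos t, [(0, rootPos t)]) := Runs.doI ⟨rfl, rfl, by simp⟩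
    have h2 : Runs (Frag.doI (Sig := Sig) (.retrieve 0)) t
        ((fun _ => rootPos t : Fin k → Pos t), [(0, rootPos t)]) ()
        (fun _ => rootPos t, []) := Runs.doI ⟨rfl, _, rfl⟩
    exact h1.bind (h.bind ((X.runs_toRoot _).bind (h2.bind (Runs.ret _ _))))
  obtain ⟨N, hN⟩ : ∃ N, ∀ q, (G.δ q).pm ≤ N := by
    have := G.fin
    obtain ⟨M, hM⟩ := (Set.finite_range fun q => (G.δ q).pm).bddAbove
    exact ⟨M, fun a => hM ⟨a, rfl⟩⟩
  refine ⟨G.toTWA rank N, G.toTWA_det N, ?_⟩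
  ext t
  exact (toTWA_accepts hN (hG t)).symm

end Convert

/-- For every ranked alphabet and every `k ≥ 1`, deterministic
`k`-head tree-walking automata with nested pebbles accept exactly the tree
languages definable in first-order logic with `k`-ary deterministic transitive
closure. -/
theorem DPTWA_eq_FODTC (Sig : Type) [Fintype Sig] (rank : Sig → ℕ)
    (k : ℕ) (hk : 1 ≤ k) :
    DPTWA Sig rank k = FODTC Sig rank k := by
  have : NeZero k := ⟨by omega⟩
  exact Set.Subset.antisymm DPTWA_subset FODTC_subset

end NestedPebbles
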